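/- The multi-sorted second-order arithmetic SA is interpretable in Ar + (Δ¹₁-C). -/

import Mathlib

namespace ArXiv150408062

/-! ### First-order arithmetic: numerical terms and arithmetical formulas -/

/-- Numerical terms, built from variables and the constants `0`, `1` by `+` and `·`. -/
inductive NTm where
  | var : ℕ → NTm
  | zero : NTm
  | one : NTm
  | add : NTm → NTm → NTm
  | mul : NTm → NTm → NTm
deriving DecidableEq

namespace NTm

def fv : NTm → Finset ℕ
  | .var i => {i}
  | .zero => ∅
  | .one => ∅
  | .add t u => t.fv ∪ u.fv
  | .mul t u => t.fv ∪ u.fv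

def maxVar : NTm → ℕ
  | .var i => i + 1
  | .zero => 0
  | .one => 0
  | .add t u => max t.maxVar u.maxVar
  | .mul t u => max t.maxVar u.maxVar

/-- Substitution of `u` for the variable `i`. -/
def subst (t : NTm) (i : ℕ) (u : NTm) : NTm :=
  match t with
  | .var j => if j = i then u else .var j
  | .zero => .zero
  | .one => .one
  | .add a b => .add (a.subst i u) (b.subst i u)
  | .mul a b => .mul (a.subst i u) (b.subst i u)

/-- Simultaneous substitution `σ` in a term. -/
def msubT (σ : ℕ → NTm) : NTm → NTm
  | .var i => σ i
  | .zero => .zero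
  | .one => .one
  | .add a b => .add (a.msubT σ) (b.msubT σ)
  | .mul a b => .mul (a.msubT σ) (b.msubT σ)

/-- Value of a term in the standard model under an evaluation of the variables. -/
def val (ρ : ℕ → ℕ) : NTm → ℕ
  | .var i => ρ i
  | .zero => 0
  | .one => 1
  | .add a b => a.val ρ + b.val ρ
  | .mul a b => a.val ρ * b.val ρ

/-- The numeral `n̄ = 1 + 1 + ⋯ + 1`. -/
def numN : ℕ → NTm
  | 0 => .zero
  | n + 1 => .add (numN n) .one

end NTm

/-- Purely arithmetical formulas (the formulas of PA). -/
inductive AFm where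
  | bot : AFm
  | eq : NTm → NTm → AFm
  | and : AFm → AFm → AFm
  | or : AFm → AFm → AFm
  | imp : AFm → AFm → AFm
  | all : ℕ → AFm → AFm
  | ex : ℕ → AFm → AFm
deriving DecidableEq

namespace AFm

def neg (φ : AFm) : AFm := φ.imp .bot
def iff (φ ψ : AFm) : AFm := (φ.imp ψ).and (ψ.imp φ)

def fv : AFm → Finset ℕ
  | .bot => ∅
  | .eq t u => t.fv ∪ u.fv
  | .and φ ψ => φ.fv ∪ ψ.fv
  | .or φ ψ => φ.fv ∪ ψ.fv
  | .imp φ ψ => φ.fv ∪ ψ.fv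
  | .all i φ => φ.fv.erase i
  | .ex i φ => φ.fv.erase i

/-- Capture-avoiding simultaneous substitution. -/
def msub (σ : ℕ → NTm) : AFm → AFm
  | .bot => .bot
  | .eq t u => .eq (t.msubT σ) (u.msubT σ)
  | .and φ ψ => .and (φ.msub σ) (ψ.msub σ)
  | .or φ ψ => .or (φ.msub σ) (ψ.msub σ)
  | .imp φ ψ => .imp (φ.msub σ) (ψ.msub σ)
  | .all i φ =>
      let j := (φ.fv.erase i).sup (fun v => (σ v).maxVar)
      .all j (φ.msub (Function.update σ i (.var j)))
  | .ex i φ =>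
      let j := (φ.fv.erase i).sup (fun v => (σ v).maxVar)
      .ex j (φ.msub (Function.update σ i (.var j)))

/-- Instantiation of the designated parameters `n₀, n₁, …` of a formula by a
list of terms. -/
def inst (α : AFm) (ts : List NTm) : AFm := α.msub (fun i => ts.getD i (.var i))

/-- Satisfaction in the standard model ℕ. -/
def sat (ρ : ℕ → ℕ) : AFm → Prop
  | .bot => False
  | .eq t u => t.val ρ = u.val ρ
  | .and φ ψ => φ.sat ρ ∧ ψ.sat ρ
  | .or φ ψ => φ.sat ρ ∨ ψ.sat ρ
  | .imp φ ψ => φ.sat ρ → ψ.sat ρ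
  | .all i φ => ∀ n : ℕ, φ.sat (Function.update ρ i n)
  | .ex i φ => ∃ n : ℕ, φ.sat (Function.update ρ i n)

end AFm

/-- The Peano axioms (with the parameters `n = n₀`, `m = n₁`). -/
inductive PeanoAx : AFm → Prop where
  | succ_ne_zero : PeanoAx ((AFm.eq (.add (.var 0) .one) .zero).neg)
  | succ_inj : PeanoAx ((AFm.eq (.add (.var 0) .one) (.add (.var 1) .one)).imp
      (.eq (.var 0) (.var 1)))
  | add_zero : PeanoAx (.eq (.add (.var 0) .zero) (.var 0))
  | add_succ : PeanoAx (.eq (.add (.var 0) (.add (.var 1) .one))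
      (.add (.add (.var 0) (.var 1)) .one))
  | mul_zero : PeanoAx (.eq (.mul (.var 0) .zero) .zero)
  | mul_succ : PeanoAx (.eq (.mul (.var 0) (.add (.var 1) .one))
      (.add (.mul (.var 0) (.var 1)) (.var 0)))

/-! ## The multi-sorted second-order arithmetic SA

The language of SA has variables over natural numbers and, for each sort
`k ≥ 1`, variables `x_i^{(k)}` over sets of natural numbers; constants `0, 1`,
functional symbols `+`, `·`, and predicate symbols `=` and `∈_k (k = 1, 2, …)`. -/

/-- Formulas of SA.  `mem k t i` is `t ∈_k x_i^{(k)}`; `allS k i φ` and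
`exS k i φ` quantify over the set variable `x_i^{(k)}` of sort `k`. -/
inductive SFm where
  | bot : SFm
  | eq : NTm → NTm → SFm
  | mem : ℕ → NTm → ℕ → SFm
  | and : SFm → SFm → SFm
  | or : SFm → SFm → SFm
  | imp : SFm → SFm → SFm
  | allN : ℕ → SFm → SFm
  | exN : ℕ → SFm → SFm
  | allS : ℕ → ℕ → SFm → SFm
  | exS : ℕ → ℕ → SFm → SFm
deriving DecidableEq

/-- Embedding of arithmetical formulas into the language of SA. -/
def AFm.toS : AFm → SFm
  | .bot => .bot
  | .eq t u => .eq t u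
  | .and φ ψ => .and φ.toS ψ.toS
  | .or φ ψ => .or φ.toS ψ.toS
  | .imp φ ψ => .imp φ.toS ψ.toS
  | .all i φ => .allN i φ.toS
  | .ex i φ => .exN i φ.toS

namespace SFm

def neg (φ : SFm) : SFm := φ.imp .bot
def iff (φ ψ : SFm) : SFm := (φ.imp ψ).and (ψ.imp φ)

/-- Free numerical variables. -/
def fvN : SFm → Finset ℕ
  | .bot => ∅
  | .eq t u => t.fv ∪ u.fv
  | .mem _ t _ => t.fv
  | .and φ ψ => φ.fvN ∪ ψ.fvN
  | .or φ ψ => φ.fvN ∪ ψ.fvN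
  | .imp φ ψ => φ.fvN ∪ ψ.fvN
  | .allN i φ => φ.fvN.erase i
  | .exN i φ => φ.fvN.erase i
  | .allS _ _ φ => φ.fvN
  | .exS _ _ φ => φ.fvN

/-- Free set variables, as pairs (sort, index). -/
def fvS : SFm → Finset (ℕ × ℕ)
  | .bot => ∅
  | .eq _ _ => ∅
  | .mem k _ i => {(k, i)}
  | .and φ ψ => φ.fvS ∪ ψ.fvS
  | .or φ ψ => φ.fvS ∪ ψ.fvS
  | .imp φ ψ => φ.fvS ∪ ψ.fvS
  | .allN _ φ => φ.fvS
  | .exN _ φ => φ.fvS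
  | .allS k i φ => φ.fvS.erase (k, i)
  | .exS k i φ => φ.fvS.erase (k, i)

/-- Substitution of a numerical term for the numerical variable `i` (naive). -/
def substN : SFm → ℕ → NTm → SFm
  | .bot, _, _ => .bot
  | .eq t u, i, w => .eq (t.subst i w) (u.subst i w)
  | .mem k t j, i, w => .mem k (t.subst i w) j
  | .and φ ψ, i, w => .and (φ.substN i w) (ψ.substN i w)
  | .or φ ψ, i, w => .or (φ.substN i w) (ψ.substN i w)
  | .imp φ ψ, i, w => .imp (φ.substN i w) (ψ.substN i w)
  | .allN j φ, i, w => if j = i then .allN j φ else .allN j (φ.substN i w)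
  | .exN j φ, i, w => if j = i then .exN j φ else .exN j (φ.substN i w)
  | .allS k j φ, i, w => .allS k j (φ.substN i w)
  | .exS k j φ, i, w => .exS k j (φ.substN i w)

/-- The numerical term `w` is substitutable for the numerical variable `i`. -/
def freeForN (w : NTm) (i : ℕ) : SFm → Prop
  | .and φ ψ => φ.freeForN w i ∧ ψ.freeForN w i
  | .or φ ψ => φ.freeForN w i ∧ ψ.freeForN w i
  | .imp φ ψ => φ.freeForN w i ∧ ψ.freeForN w i
  | .allN j φ => i ∉ (φ.fvN.erase j) ∨ (j ∉ w.fv ∧ φ.freeForN w i)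
  | .exN j φ => i ∉ (φ.fvN.erase j) ∨ (j ∉ w.fv ∧ φ.freeForN w i)
  | .allS _ _ φ => φ.freeForN w i
  | .exS _ _ φ => φ.freeForN w i
  | _ => True

/-- Substitution of the set variable `x_j^{(k)}` for the set variable
`x_i^{(k)}` (naive). -/
def substS : SFm → ℕ → ℕ → ℕ → SFm
  | .bot, _, _, _ => .bot
  | .eq t u, _, _, _ => .eq t u
  | .mem k' t i', k, i, j =>
      if k' = k ∧ i' = i then .mem k t j else .mem k' t i'
  | .and φ ψ, k, i, j => .and (φ.substS k i j) (ψ.substS k i j)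
  | .or φ ψ, k, i, j => .or (φ.substS k i j) (ψ.substS k i j)
  | .imp φ ψ, k, i, j => .imp (φ.substS k i j) (ψ.substS k i j)
  | .allN n φ, k, i, j => .allN n (φ.substS k i j)
  | .exN n φ, k, i, j => .exN n (φ.substS k i j)
  | .allS k' i' φ, k, i, j =>
      if k' = k ∧ i' = i then .allS k' i' φ else .allS k' i' (φ.substS k i j)
  | .exS k' i' φ, k, i, j =>
      if k' = k ∧ i' = i then .exS k' i' φ else .exS k' i' (φ.substS k i j)

/-- The set variable `x_j^{(k)}` is substitutable for `x_i^{(k)}`. -/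
def freeForS (k i j : ℕ) : SFm → Prop
  | .and φ ψ => φ.freeForS k i j ∧ ψ.freeForS k i j
  | .or φ ψ => φ.freeForS k i j ∧ ψ.freeForS k i j
  | .imp φ ψ => φ.freeForS k i j ∧ ψ.freeForS k i j
  | .allN _ φ => φ.freeForS k i j
  | .exN _ φ => φ.freeForS k i j
  | .allS k' i' φ => (k, i) ∉ (φ.fvS.erase (k', i')) ∨ ((k', i') ≠ (k, j) ∧ φ.freeForS k i j)
  | .exS k' i' φ => (k, i) ∉ (φ.fvS.erase (k', i')) ∨ ((k', i') ≠ (k, j) ∧ φ.freeForS k i j)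
  | _ => True

/-- Capture-avoiding simultaneous substitution of numerical terms for the
numerical variables. -/
def msubN (σ : ℕ → NTm) : SFm → SFm
  | .bot => .bot
  | .eq t u => .eq (t.msubT σ) (u.msubT σ)
  | .mem k t i => .mem k (t.msubT σ) i
  | .and φ ψ => .and (φ.msubN σ) (ψ.msubN σ)
  | .or φ ψ => .or (φ.msubN σ) (ψ.msubN σ)
  | .imp φ ψ => .imp (φ.msubN σ) (ψ.msubN σ)
  | .allN i φ =>
      let j := (φ.fvN.erase i).sup (fun v => (σ v).maxVar)
      .allN j (φ.msubN (Function.update σ i (.var j)))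
  | .exN i φ =>
      let j := (φ.fvN.erase i).sup (fun v => (σ v).maxVar)
      .exN j (φ.msubN (Function.update σ i (.var j)))
  | .allS k i φ => .allS k i (φ.msubN σ)
  | .exS k i φ => .exS k i (φ.msubN σ)

/-- `φ` is `k`-simple: no quantifiers over set variables and no variables of
sorts greater than `k`. -/
def simple (k : ℕ) : SFm → Prop
  | .bot => True
  | .eq _ _ => True
  | .mem j _ _ => j ≤ k
  | .and φ ψ => φ.simple k ∧ ψ.simple k
  | .or φ ψ => φ.simple k ∧ ψ.simple k
  | .imp φ ψ => φ.simple k ∧ ψ.simple k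
  | .allN _ φ => φ.simple k
  | .exN _ φ => φ.simple k
  | .allS _ _ _ => False
  | .exS _ _ _ => False

/-- `φ` has no quantifiers over set variables. -/
def noSetQ : SFm → Prop
  | .and φ ψ => φ.noSetQ ∧ ψ.noSetQ
  | .or φ ψ => φ.noSetQ ∧ ψ.noSetQ
  | .imp φ ψ => φ.noSetQ ∧ ψ.noSetQ
  | .allN _ φ => φ.noSetQ
  | .exN _ φ => φ.noSetQ
  | .allS _ _ _ => False
  | .exS _ _ _ => False
  | _ => True

/-- All sorts occurring in `φ` are `≤ s`. -/
def sortLE (s : ℕ∞) : SFm → Prop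
  | .bot => True
  | .eq _ _ => True
  | .mem k _ _ => (k : ℕ∞) ≤ s
  | .and φ ψ => φ.sortLE s ∧ ψ.sortLE s
  | .or φ ψ => φ.sortLE s ∧ ψ.sortLE s
  | .imp φ ψ => φ.sortLE s ∧ ψ.sortLE s
  | .allN _ φ => φ.sortLE s
  | .exN _ φ => φ.sortLE s
  | .allS k _ φ => (k : ℕ∞) ≤ s ∧ φ.sortLE s
  | .exS k _ φ => (k : ℕ∞) ≤ s ∧ φ.sortLE s

end SFm

/-- The formula `p = (n, m)` for the fixed (Cantor) numbering of pairs of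
natural numbers: `2·p = (n+m)·(n+m+1) + 2·m`. -/
def pairEq (p n m : NTm) : SFm :=
  .eq (.add p p) (.add (.mul (.add n m) (.add (.add n m) .one)) (.add m m))

/-- The Cantor pairing function on ℕ (the fixed numbering of pairs). -/
def cpair (n m : ℕ) : ℕ := (n + m) * (n + m + 1) / 2 + m

/-- `(n,m) ∈_k x_y^{(k)}`, i.e. `∃p(p = (n,m) ∧ p ∈_k x_y^{(k)})`. -/
def pairMem (k : ℕ) (n m : NTm) (y : ℕ) (p : ℕ) : SFm :=
  .exN p ((pairEq (.var p) n m).and (.mem k (.var p) y))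

/-! ### Axioms and derivability for SA -/

/-- The non-logical axioms of SA: Peano axioms, induction for all formulas,
comprehension for `k`-simple formulas, and the axiom of choice for `k`-simple
formulas. -/
inductive SAx : SFm → Prop where
  | peano {α : AFm} : PeanoAx α → SAx α.toS
  | ind (φ : SFm) (i : ℕ) :
      SAx (((φ.substN i .zero).and
        (.allN i (φ.imp (φ.substN i (.add (.var i) .one))))).imp (.allN i φ))
  | compr (k z j : ℕ) (φ : SFm) (h : φ.simple k) (hz : (k, z) ∉ φ.fvS) :
      SAx (.exS k z (.allN j ((SFm.mem k (.var j) z).iff φ)))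
  | choice (k : ℕ) (φ : SFm) (n ix iz iy q m p : ℕ)
      (h : φ.simple k)
      (hiz : (k, iz) ∉ φ.fvS) (hizx : iz ≠ ix)
      (hq : q ∉ φ.fvN ∧ q ≠ n) (hm : m ∉ φ.fvN ∧ m ≠ n)
      (hp : p ∉ φ.fvN ∧ p ≠ n ∧ p ≠ m) :
      SAx ((SFm.allN n (.exS k ix (φ.and (.allS k iz ((φ.substS k ix iz).imp
              (.allN q ((SFm.mem k (.var q) ix).iff (.mem k (.var q) iz)))))))).imp
           (.exS (k+1) iy (.allN n (.exS k ix (φ.and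
              (.allN m ((SFm.mem k (.var m) ix).iff
                (pairMem (k+1) (.var n) (.var m) iy p))))))))

/-- Logical axioms for the (classical, many-sorted) language of SA:
propositional axioms, double-negation elimination, quantifier axioms for
numerical and for set quantifiers, and equality axioms. -/
inductive SLogAx : SFm → Prop where
  | pl1 (φ ψ : SFm) : SLogAx (φ.imp (ψ.imp φ))
  | pl2 (φ ψ χ : SFm) : SLogAx ((φ.imp (ψ.imp χ)).imp ((φ.imp ψ).imp (φ.imp χ)))
  | pl3 (φ ψ : SFm) : SLogAx (φ.imp (ψ.imp (φ.and ψ)))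
  | pl4 (φ ψ : SFm) : SLogAx ((φ.and ψ).imp φ)
  | pl5 (φ ψ : SFm) : SLogAx ((φ.and ψ).imp ψ)
  | pl6 (φ ψ : SFm) : SLogAx (φ.imp (φ.or ψ))
  | pl7 (φ ψ : SFm) : SLogAx (ψ.imp (φ.or ψ))
  | pl8 (φ ψ χ : SFm) : SLogAx ((φ.imp χ).imp ((ψ.imp χ).imp ((φ.or ψ).imp χ)))
  | pl9 (φ : SFm) : SLogAx (SFm.bot.imp φ)
  | em (φ : SFm) : SLogAx ((φ.neg.neg).imp φ)
  | qa1 (i : ℕ) (φ : SFm) (t : NTm) (hf : φ.freeForN t i) :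
      SLogAx ((SFm.allN i φ).imp (φ.substN i t))
  | qa2 (i : ℕ) (φ : SFm) (t : NTm) (hf : φ.freeForN t i) :
      SLogAx ((φ.substN i t).imp (.exN i φ))
  | qa3 (k i j : ℕ) (φ : SFm) (hf : φ.freeForS k i j) :
      SLogAx ((SFm.allS k i φ).imp (φ.substS k i j))
  | qa4 (k i j : ℕ) (φ : SFm) (hf : φ.freeForS k i j) :
      SLogAx ((φ.substS k i j).imp (.exS k i φ))
  | eqRefl (t : NTm) : SLogAx (.eq t t)
  | eqSubst (i : ℕ) (t u : NTm) (φ : SFm)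
      (h1 : φ.freeForN t i) (h2 : φ.freeForN u i) :
      SLogAx ((SFm.eq t u).imp ((φ.substN i t).imp (φ.substN i u)))

/-- Derivability over the language of SA from logical axioms and a set `ax` of
non-logical axioms, with the language restriction `L`. -/
inductive SProvG (L : SFm → Prop) (ax : SFm → Prop) : SFm → Prop where
  | axm {φ : SFm} : SLogAx φ → L φ → SProvG L ax φ
  | extra {φ : SFm} : ax φ → L φ → SProvG L ax φ
  | mp {φ ψ : SFm} : SProvG L ax (φ.imp ψ) → SProvG L ax φ → SProvG L ax ψ
  | allRN {ψ : SFm} {i : ℕ} {φ : SFm} : SProvG L ax (ψ.imp φ) → i ∉ ψ.fvN →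
      L (.allN i φ) → SProvG L ax (ψ.imp (.allN i φ))
  | exRN {ψ : SFm} {i : ℕ} {φ : SFm} : SProvG L ax (φ.imp ψ) → i ∉ ψ.fvN →
      L (.exN i φ) → SProvG L ax ((SFm.exN i φ).imp ψ)
  | allRS {ψ : SFm} {k i : ℕ} {φ : SFm} : SProvG L ax (ψ.imp φ) → (k, i) ∉ ψ.fvS →
      L (.allS k i φ) → SProvG L ax (ψ.imp (.allS k i φ))
  | exRS {ψ : SFm} {k i : ℕ} {φ : SFm} : SProvG L ax (φ.imp ψ) → (k, i) ∉ ψ.fvS →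
      L (.exS k i φ) → SProvG L ax ((SFm.exS k i φ).imp ψ)

/-- Derivability in (the fragment with sorts `≤ s` of) the multi-sorted
second-order arithmetic SA; `SAProv ⊤` is derivability in full SA, `SAProv s`
(for `s : ℕ`) is derivability in the fragment `SA_s` (`SA_0 = PA`). -/
def SAProv (s : ℕ∞) : SFm → Prop := SProvG (fun φ => φ.sortLE s) SAx

/-! ## The predicative second-order arithmetic Ar and its extensions

Ar has one sort of set variables; we render its formulas as the formulas of SA
in which all set variables and membership predicates have sort 1. -/

/-- The non-logical axioms of Ar: Peano axioms, induction for all formulas and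
comprehension for formulas without quantifiers over set variables. -/
inductive ArAx : SFm → Prop where
  | peano {α : AFm} : PeanoAx α → ArAx α.toS
  | ind (φ : SFm) (i : ℕ) :
      ArAx (((φ.substN i .zero).and
        (.allN i (φ.imp (φ.substN i (.add (.var i) .one))))).imp (.allN i φ))
  | compr (z j : ℕ) (φ : SFm) (h : φ.noSetQ) (hz : (1, z) ∉ φ.fvS) :
      ArAx (.exS 1 z (.allN j ((SFm.mem 1 (.var j) z).iff φ)))

/-- The unique-choice scheme (AC!):
`∀k∃!x φ(k,x) ⊃ ∃y∀k∃x[φ(k,x) ∧ ∀m(m ∈ x ≡ (k,m) ∈ y)]`,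
for `φ` without quantifiers over set variables and not containing `y`
(with `∃!x φ` expanded using the defined set equality `∀q(q∈x ≡ q∈z)`). -/
inductive ACBang : SFm → Prop where
  | intro (φ : SFm) (n ix iz iy q m p : ℕ)
      (h : φ.noSetQ)
      (hiz : (1, iz) ∉ φ.fvS) (hizx : iz ≠ ix)
      (hiy : (1, iy) ∉ φ.fvS) (hiyx : iy ≠ ix) (hiyz : iy ≠ iz)
      (hq : q ∉ φ.fvN ∧ q ≠ n) (hm : m ∉ φ.fvN ∧ m ≠ n)
      (hp : p ∉ φ.fvN ∧ p ≠ n ∧ p ≠ m) :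
      ACBang ((SFm.allN n (.exS 1 ix (φ.and (.allS 1 iz ((φ.substS 1 ix iz).imp
          (.allN q ((SFm.mem 1 (.var q) ix).iff (.mem 1 (.var q) iz)))))))).imp
        (.exS 1 iy (.allN n (.exS 1 ix (φ.and
          (.allN m ((SFm.mem 1 (.var m) ix).iff
            (pairMem 1 (.var n) (.var m) iy p))))))))

/-- The `Δ¹₁`-comprehension scheme (Δ¹₁-C):
`∀n[∀v φ(n,v) ≡ ∃u ψ(n,u)] ⊃ ∃z∀n[n ∈ z ≡ ∃u ψ(n,u)]`,
where `φ` and `ψ` have no quantifiers over set variables and do not contain `z`. -/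
inductive DeltaC : SFm → Prop where
  | intro (φ ψ : SFm) (n iv iu iz : ℕ)
      (hφ : φ.noSetQ) (hψ : ψ.noSetQ)
      (hz1 : (1, iz) ∉ φ.fvS) (hz2 : (1, iz) ∉ ψ.fvS)
      (hzu : iz ≠ iu) (hzv : iz ≠ iv) :
      DeltaC ((SFm.allN n ((SFm.allS 1 iv φ).iff (.exS 1 iu ψ))).imp
        (.exS 1 iz (.allN n ((SFm.mem 1 (.var n) iz).iff (.exS 1 iu ψ)))))

/-- Derivability in Ar extended by the scheme `extra` (over the one-sorted
language: all set sorts are `= 1`). -/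
def ArProv (extra : SFm → Prop) : SFm → Prop :=
  SProvG (fun φ => φ.sortLE 1) (fun φ => ArAx φ ∨ extra φ)

/-- The interpretation `φ ↦ φ^∧` of SA in Ar: all sorts are removed and the set
variable `x_i^{(k)}` is renamed into `x_{(k,i)}`. -/
def hatTr : SFm → SFm
  | .bot => .bot
  | .eq t u => .eq t u
  | .mem k t i => .mem 1 t (Nat.pair k i)
  | .and φ ψ => .and (hatTr φ) (hatTr ψ)
  | .or φ ψ => .or (hatTr φ) (hatTr ψ)
  | .imp φ ψ => .imp (hatTr φ) (hatTr ψ)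
  | .allN i φ => .allN i (hatTr φ)
  | .exN i φ => .exN i (hatTr φ)
  | .allS k i φ => .allS 1 (Nat.pair k i) (hatTr φ)
  | .exS k i φ => .exS 1 (Nat.pair k i) (hatTr φ)

/-! ## Syntactic lemmas -/

namespace NTm

theorem lt_maxVar_of_mem_fv {t : NTm} {v : ℕ} (h : v ∈ t.fv) : v < t.maxVar := by
  induction t with
  | var i => simp [fv, maxVar] at *; omega
  | zero => simp [fv] at h
  | one => simp [fv] at h
  | add a b iha ihb => simp only [fv, maxVar, Finset.mem_union, lt_max_iff] at *; tauto
  | mul a b iha ihb => simp only [fv, maxVar, Finset.mem_union, lt_max_iff] at *; tauto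

theorem notMem_fv_of_maxVar_le {t : NTm} {v : ℕ} (h : t.maxVar ≤ v) : v ∉ t.fv :=
  fun hv => absurd (lt_maxVar_of_mem_fv hv) (by omega)

theorem subst_of_notMem {t : NTm} {i : ℕ} (u : NTm) (h : i ∉ t.fv) : t.subst i u = t := by
  induction t with
  | var j => simp only [fv, Finset.mem_singleton] at h; simp [subst, Ne.symm h]
  | zero => rfl
  | one => rfl
  | add a b iha ihb => simp only [fv, Finset.mem_union, not_or] at h; simp [subst, iha h.1, ihb h.2]
  | mul a b iha ihb => simp only [fv, Finset.mem_union, not_or] at h; simp [subst, iha h.1, ihb h.2]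

theorem subst_self (t : NTm) (i : ℕ) : t.subst i (.var i) = t := by
  induction t with
  | var j => by_cases h : j = i <;> simp [subst, h]
  | _ => simp_all [subst]

theorem subst_subst_self (t : NTm) (i : ℕ) (u w : NTm) :
    (t.subst i u).subst i w = t.subst i (u.subst i w) := by
  induction t with
  | var j => by_cases h : j = i <;> simp [subst, h]
  | _ => simp_all [subst]

theorem subst_var_subst {t : NTm} {c : ℕ} (i : ℕ) (u : NTm) (h : c ∉ t.fv) :
    (t.subst i (.var c)).subst c u = t.subst i u := by
  induction t with
  | var j =>
    simp only [fv, Finset.mem_singleton] at h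
    by_cases hj : j = i <;> simp [subst, hj]
    rintro rfl; exact absurd rfl h
  | zero => rfl
  | one => rfl
  | add a b iha ihb => simp only [fv, Finset.mem_union, not_or] at h; simp [subst, iha h.1, ihb h.2]
  | mul a b iha ihb => simp only [fv, Finset.mem_union, not_or] at h; simp [subst, iha h.1, ihb h.2]

/-- A Gödel number for terms. -/
def code : NTm → ℕ
  | .var i => Nat.pair 0 i
  | .zero => Nat.pair 1 0
  | .one => Nat.pair 2 0
  | .add a b => Nat.pair 3 (Nat.pair a.code b.code)
  | .mul a b => Nat.pair 4 (Nat.pair a.code b.code)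

theorem code_injective : Function.Injective code := by
  intro a
  induction a <;> intro b h <;> cases b <;> simp_all [code, Nat.pair_eq_pair]
  all_goals grind [Function.Injective]

end NTm

namespace SFm

/-- A Gödel number for formulas. -/
def code : SFm → ℕ
  | .bot => Nat.pair 0 0
  | .eq t u => Nat.pair 1 (Nat.pair t.code u.code)
  | .mem k t i => Nat.pair 2 (Nat.pair k (Nat.pair t.code i))
  | .and φ ψ => Nat.pair 3 (Nat.pair φ.code ψ.code)
  | .or φ ψ => Nat.pair 4 (Nat.pair φ.code ψ.code)
  | .imp φ ψ => Nat.pair 5 (Nat.pair φ.code ψ.code)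
  | .allN i φ => Nat.pair 6 (Nat.pair i φ.code)
  | .exN i φ => Nat.pair 7 (Nat.pair i φ.code)
  | .allS k i φ => Nat.pair 8 (Nat.pair k (Nat.pair i φ.code))
  | .exS k i φ => Nat.pair 9 (Nat.pair k (Nat.pair i φ.code))

theorem code_injective : Function.Injective code := by
  intro a
  induction a <;> intro b h <;> cases b <;>
    simp_all [code, Nat.pair_eq_pair, NTm.code_injective.eq_iff]
  all_goals grind [Function.Injective]

instance : Countable SFm := code_injective.countable

/-- A strict upper bound for all numerical variables occurring in a formula, free or bound. -/
def bdN : SFm → ℕ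
  | .bot => 0
  | .eq t u => max t.maxVar u.maxVar
  | .mem _ t _ => t.maxVar
  | .and φ ψ => max φ.bdN ψ.bdN
  | .or φ ψ => max φ.bdN ψ.bdN
  | .imp φ ψ => max φ.bdN ψ.bdN
  | .allN i φ => max (i + 1) φ.bdN
  | .exN i φ => max (i + 1) φ.bdN
  | .allS _ _ φ => φ.bdN
  | .exS _ _ φ => φ.bdN

/-- A strict upper bound for the indices of all set variables occurring in a formula,
free or bound. -/
def bdS : SFm → ℕ
  | .bot => 0
  | .eq _ _ => 0
  | .mem _ _ i => i + 1
  | .and φ ψ => max φ.bdS ψ.bdS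
  | .or φ ψ => max φ.bdS ψ.bdS
  | .imp φ ψ => max φ.bdS ψ.bdS
  | .allN _ φ => φ.bdS
  | .exN _ φ => φ.bdS
  | .allS _ i φ => max (i + 1) φ.bdS
  | .exS _ i φ => max (i + 1) φ.bdS

theorem lt_bdN_of_mem_fvN {φ : SFm} {v : ℕ} (h : v ∈ φ.fvN) : v < φ.bdN := by
  induction φ with
  | bot => simp [fvN] at h
  | eq t u =>
    simp only [fvN, bdN, Finset.mem_union, lt_max_iff] at *
    exact h.imp NTm.lt_maxVar_of_mem_fv NTm.lt_maxVar_of_mem_fv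
  | mem k t i => exact NTm.lt_maxVar_of_mem_fv h
  | _ => simp only [fvN, bdN, Finset.mem_union, Finset.mem_erase, lt_max_iff] at *; tauto

theorem lt_bdS_of_mem_fvS {φ : SFm} {k v : ℕ} (h : (k, v) ∈ φ.fvS) : v < φ.bdS := by
  induction φ with
  | mem j t i => simp [fvS, bdS] at *; omega
  | bot => simp [fvS] at h
  | eq => simp [fvS] at h
  | _ => simp only [fvS, bdS, Finset.mem_union, Finset.mem_erase, lt_max_iff] at *; tauto

theorem notMem_fvN_of_bdN_le {φ : SFm} {v : ℕ} (h : φ.bdN ≤ v) : v ∉ φ.fvN :=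
  fun hv => absurd (lt_bdN_of_mem_fvN hv) (by omega)

theorem notMem_fvS_of_bdS_le {φ : SFm} {k v : ℕ} (h : φ.bdS ≤ v) : (k, v) ∉ φ.fvS :=
  fun hv => absurd (lt_bdS_of_mem_fvS hv) (by omega)

theorem substN_of_notMem {φ : SFm} {i : ℕ} (t : NTm) (h : i ∉ φ.fvN) : φ.substN i t = φ := by
  induction φ with
  | bot => rfl
  | eq a b =>
    simp only [fvN, Finset.mem_union, not_or] at h
    simp [substN, NTm.subst_of_notMem t h.1, NTm.subst_of_notMem t h.2]
  | mem k a j => simp [substN, NTm.subst_of_notMem t h]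
  | allN j φ ih =>
    by_cases hj : j = i
    · simp [substN, hj]
    · simp only [fvN, Finset.mem_erase, not_and, substN, hj, if_false] at h ⊢
      rw [ih (h (Ne.symm hj))]
  | exN j φ ih =>
    by_cases hj : j = i
    · simp [substN, hj]
    · simp only [fvN, Finset.mem_erase, not_and, substN, hj, if_false] at h ⊢
      rw [ih (h (Ne.symm hj))]
  | _ => simp_all [substN, fvN]

theorem substS_of_notMem {φ : SFm} {k i : ℕ} (j : ℕ) (h : (k, i) ∉ φ.fvS) :
    φ.substS k i j = φ := by
  induction φ with
  | mem k' a j => simp [fvS] at h; simp [substS]; rintro rfl rfl; simp at h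
  | allS k' i' φ ih =>
    by_cases hj : k' = k ∧ i' = i
    · simp [substS, hj]
    · simp only [fvS, Finset.mem_erase, not_and, substS, hj, if_false] at h ⊢
      rw [ih (h (by simpa only [ne_eq, Prod.mk.injEq, eq_comm] using hj))]
  | exS k' i' φ ih =>
    by_cases hj : k' = k ∧ i' = i
    · simp [substS, hj]
    · simp only [fvS, Finset.mem_erase, not_and, substS, hj, if_false] at h ⊢
      rw [ih (h (by simpa only [ne_eq, Prod.mk.injEq, eq_comm] using hj))]
  | _ => simp_all [substS, fvS]

theorem substN_self (φ : SFm) (i : ℕ) : φ.substN i (.var i) = φ := by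
  induction φ <;> simp_all [substN, NTm.subst_self]

theorem substS_self (φ : SFm) (k i : ℕ) : φ.substS k i i = φ := by
  induction φ <;> simp_all [substS]

theorem freeForN_of_notMem_or {φ : SFm} {t : NTm} {i : ℕ} (h : ∀ v ∈ t.fv, v = i ∨ φ.bdN ≤ v) :
    φ.freeForN t i := by
  induction φ with
  | bot => trivial
  | eq => trivial
  | mem => trivial
  | allN j φ ih =>
    simp only [bdN, max_le_iff, freeForN] at *
    by_cases hj : j = i
    · left; simp [hj]
    · refine .inr ⟨fun hm => ?_, ih fun v hv => (h v hv).imp_right And.right⟩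
      rcases h j hm with h | h <;> omega
  | exN j φ ih =>
    simp only [bdN, max_le_iff, freeForN] at *
    by_cases hj : j = i
    · left; simp [hj]
    · refine .inr ⟨fun hm => ?_, ih fun v hv => (h v hv).imp_right And.right⟩
      rcases h j hm with h | h <;> omega
  | allS k j φ ih => exact ih h
  | exS k j φ ih => exact ih h
  | _ =>
    rename_i ih1 ih2
    simp only [bdN, max_le_iff, freeForN] at *
    exact ⟨ih1 fun v hv => (h v hv).imp_right And.left,
      ih2 fun v hv => (h v hv).imp_right And.right⟩

theorem freeForN_var {φ : SFm} {c i : ℕ} (h : φ.bdN ≤ c) : φ.freeForN (.var c) i :=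
  freeForN_of_notMem_or (by simp [NTm.fv, h])

theorem freeForN_self (φ : SFm) (i : ℕ) : φ.freeForN (.var i) i :=
  freeForN_of_notMem_or (by simp [NTm.fv])

theorem freeForS_of_eq_or {φ : SFm} {k i j : ℕ} (h : j = i ∨ φ.bdS ≤ j) :
    φ.freeForS k i j := by
  induction φ with
  | bot => trivial
  | eq => trivial
  | mem => trivial
  | allS k' i' φ ih =>
    simp only [bdS, max_le_iff, freeForS] at *
    by_cases hj : (k', i') = (k, i)
    · left; simp [hj]
    · refine .inr ⟨?_, ih (h.imp_right And.right)⟩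
      rcases h with h | h
      · rwa [h]
      · simp; omega
  | exS k' i' φ ih =>
    simp only [bdS, max_le_iff, freeForS] at *
    by_cases hj : (k', i') = (k, i)
    · left; simp [hj]
    · refine .inr ⟨?_, ih (h.imp_right And.right)⟩
      rcases h with h | h
      · rwa [h]
      · simp; omega
  | allN j φ ih => exact ih h
  | exN j φ ih => exact ih h
  | _ =>
    rename_i ih1 ih2
    simp only [bdS, max_le_iff, freeForS] at *
    exact ⟨ih1 (h.imp_right And.left), ih2 (h.imp_right And.right)⟩

theorem substN_var_substN {φ : SFm} {c : ℕ} (i : ℕ) (h : φ.bdN ≤ c) :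
    (φ.substN i (.var c)).substN c (.var i) = φ := by
  induction φ with
  | bot => rfl
  | eq a b =>
    simp only [bdN, max_le_iff] at h
    simp [substN, NTm.subst_var_subst, NTm.notMem_fv_of_maxVar_le h.1,
      NTm.notMem_fv_of_maxVar_le h.2, NTm.subst_self]
  | mem k a j =>
    simp [substN, NTm.subst_var_subst, NTm.notMem_fv_of_maxVar_le h, NTm.subst_self]
  | allN j φ ih =>
    simp only [bdN, max_le_iff] at h
    have hc : j ≠ c := by omega
    by_cases hj : j = i
    · simp [substN, hj, substN_of_notMem _ (notMem_fvN_of_bdN_le h.2)]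
    · simp [substN, hj, hc, ih h.2]
  | exN j φ ih =>
    simp only [bdN, max_le_iff] at h
    have hc : j ≠ c := by omega
    by_cases hj : j = i
    · simp [substN, hj, substN_of_notMem _ (notMem_fvN_of_bdN_le h.2)]
    · simp [substN, hj, hc, ih h.2]
  | _ => simp_all [substN, bdN]

theorem freeForN_substN_var {φ : SFm} {c : ℕ} (i : ℕ) (h : φ.bdN ≤ c) :
    (φ.substN i (.var c)).freeForN (.var i) c := by
  induction φ with
  | allN j φ ih =>
    simp only [bdN, max_le_iff] at h
    have := notMem_fvN_of_bdN_le h.2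
    by_cases hj : j = i
    · simp [substN, hj, freeForN, this]
    · simp [substN, hj, freeForN, ih h.2, NTm.fv]
  | exN j φ ih =>
    simp only [bdN, max_le_iff] at h
    have := notMem_fvN_of_bdN_le h.2
    by_cases hj : j = i
    · simp [substN, hj, freeForN, this]
    · simp [substN, hj, freeForN, ih h.2, NTm.fv]
  | _ => simp_all [substN, bdN, freeForN]

theorem substS_substS_var {φ : SFm} {c : ℕ} (k i : ℕ) (h : φ.bdS ≤ c) :
    (φ.substS k i c).substS k c i = φ := by
  induction φ with
  | mem k' a j =>
    simp only [bdS] at h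
    by_cases hj : k' = k ∧ j = i
    · simp [substS, hj]
    · have : j ≠ c := by omega
      simp [substS, hj, this]
  | allS k' j φ ih =>
    simp only [bdS, max_le_iff] at h
    have hc : j ≠ c := by omega
    by_cases hj : k' = k ∧ j = i
    · simp [substS, hj, substS_of_notMem _ (notMem_fvS_of_bdS_le h.2)]
    · simp [substS, hj, hc, ih h.2]
  | exS k' j φ ih =>
    simp only [bdS, max_le_iff] at h
    have hc : j ≠ c := by omega
    by_cases hj : k' = k ∧ j = i
    · simp [substS, hj, substS_of_notMem _ (notMem_fvS_of_bdS_le h.2)]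
    · simp [substS, hj, hc, ih h.2]
  | _ => simp_all [substS, bdS]

theorem freeForS_substS_var {φ : SFm} {c : ℕ} (k i : ℕ) (h : φ.bdS ≤ c) :
    (φ.substS k i c).freeForS k c i := by
  induction φ with
  | allS k' j φ ih =>
    simp only [bdS, max_le_iff] at h
    have := notMem_fvS_of_bdS_le (k := k) h.2
    by_cases hj : k' = k ∧ j = i
    · simp [substS, hj, freeForS, this]
    · simp [substS, hj, freeForS, ih h.2]
  | exS k' j φ ih =>
    simp only [bdS, max_le_iff] at h
    have := notMem_fvS_of_bdS_le (k := k) h.2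
    by_cases hj : k' = k ∧ j = i
    · simp [substS, hj, freeForS, this]
    · simp [substS, hj, freeForS, ih h.2]
  | mem k' a j => by_cases hj : k' = k ∧ j = i <;> simp [substS, hj, freeForS]
  | _ => simp_all [substS, bdS, freeForS]

theorem substN_substN_self (φ : SFm) (i : ℕ) (u w : NTm) :
    (φ.substN i u).substN i w = φ.substN i (u.subst i w) := by
  induction φ with
  | allN j φ ih => by_cases hj : j = i <;> simp [substN, hj, ih]
  | exN j φ ih => by_cases hj : j = i <;> simp [substN, hj, ih]
  | _ => simp_all [substN, NTm.subst_subst_self]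

theorem substN_substS (φ : SFm) (n : ℕ) (t : NTm) (k i j : ℕ) :
    (φ.substS k i j).substN n t = (φ.substN n t).substS k i j := by
  induction φ with
  | mem k' a l => by_cases h : k' = k ∧ l = i <;> simp [substN, substS, h]
  | allN l φ ih => by_cases h : l = n <;> simp [substN, substS, h, ih]
  | exN l φ ih => by_cases h : l = n <;> simp [substN, substS, h, ih]
  | allS k' l φ ih => by_cases h : k' = k ∧ l = i <;> simp [substN, substS, h, ih]
  | exS k' l φ ih => by_cases h : k' = k ∧ l = i <;> simp [substN, substS, h, ih]
  | _ => simp_all [substN, substS]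

theorem fvN_substS (φ : SFm) (k i j : ℕ) : (φ.substS k i j).fvN = φ.fvN := by
  induction φ with
  | mem k' a l => by_cases h : k' = k ∧ l = i <;> simp [fvN, substS, h]
  | allS k' l φ ih => by_cases h : k' = k ∧ l = i <;> simp [fvN, substS, h, ih]
  | exS k' l φ ih => by_cases h : k' = k ∧ l = i <;> simp [fvN, substS, h, ih]
  | _ => simp_all [fvN, substS]

theorem bdN_substS (φ : SFm) (k i j : ℕ) : (φ.substS k i j).bdN = φ.bdN := by
  induction φ with
  | mem k' a l => by_cases h : k' = k ∧ l = i <;> simp [bdN, substS, h]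
  | allS k' l φ ih => by_cases h : k' = k ∧ l = i <;> simp [bdN, substS, h, ih]
  | exS k' l φ ih => by_cases h : k' = k ∧ l = i <;> simp [bdN, substS, h, ih]
  | _ => simp_all [bdN, substS]

theorem fvS_substN (φ : SFm) (n : ℕ) (t : NTm) : (φ.substN n t).fvS = φ.fvS := by
  induction φ with
  | allN l φ ih => by_cases h : l = n <;> simp [fvS, substN, h, ih]
  | exN l φ ih => by_cases h : l = n <;> simp [fvS, substN, h, ih]
  | _ => simp_all [fvS, substN]

theorem simple.noSetQ {k : ℕ} {φ : SFm} (h : φ.simple k) : φ.noSetQ := by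
  induction φ <;> simp_all [simple, SFm.noSetQ]

theorem simple.sort_le {k : ℕ} {φ : SFm} (h : φ.simple k) {j i : ℕ} (hm : (j, i) ∈ φ.fvS) :
    j ≤ k := by
  induction φ with
  | mem => simp_all [simple, fvS]
  | _ => simp_all [simple, fvS] <;> tauto

theorem notMem_fvS_substS {φ : SFm} (hφ : φ.noSetQ) {k i j : ℕ} (h : j ≠ i) :
    (k, i) ∉ (φ.substS k i j).fvS := by
  induction φ with
  | mem k' a l =>
    by_cases hl : k' = k ∧ l = i
    · simp [fvS, substS, hl, h.symm]
    · simp [fvS, substS, hl]; omega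
  | _ => simp_all [SFm.noSetQ, substS, fvS]

theorem substS_substS {φ : SFm} (hφ : φ.noSetQ) {k i j : ℕ} (l : ℕ) (h : (k, j) ∉ φ.fvS) :
    (φ.substS k i j).substS k j l = φ.substS k i l := by
  induction φ with
  | mem k' a l =>
    simp only [fvS, Finset.mem_singleton, Prod.mk.injEq] at h
    by_cases hl : k' = k ∧ l = i
    · simp [substS, hl]
    · have : ¬ (k' = k ∧ l = j) := by omega
      simp [substS, hl, this]
  | _ => simp_all [SFm.noSetQ, substS, fvS]

end SFm

/-! ## Derivations in the unrestricted language -/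

/-- Derivability from the axioms `ax` without a language restriction. -/
abbrev Prov (ax : SFm → Prop) : SFm → Prop := SProvG (fun _ => True) ax

namespace Prov

variable {ax : SFm → Prop} {φ ψ χ σ : SFm}

theorem log (h : SLogAx φ) : Prov ax φ := .axm h trivial

theorem weaken (h : Prov ax φ) (ψ : SFm) : Prov ax (ψ.imp φ) := .mp (log (.pl1 _ _)) h

theorem mp_ctx (h : Prov ax (σ.imp (φ.imp ψ))) (h' : Prov ax (σ.imp φ)) : Prov ax (σ.imp ψ) :=
  .mp (.mp (log (.pl2 _ _ _)) h) h'

theorem trans (h : Prov ax (φ.imp ψ)) (h' : Prov ax (ψ.imp χ)) : Prov ax (φ.imp χ) :=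
  mp_ctx (weaken h' φ) h

theorem refl (φ : SFm) : Prov ax (φ.imp φ) :=
  mp_ctx (ψ := φ) (log (.pl1 φ (φ.imp φ))) (log (.pl1 φ φ))

theorem curry (h : Prov ax ((σ.and φ).imp χ)) : Prov ax (σ.imp (φ.imp χ)) :=
  trans (log (.pl3 _ _)) (.mp (log (.pl2 _ _ _)) (weaken h φ))

theorem uncurry (h : Prov ax (σ.imp (φ.imp χ))) : Prov ax ((σ.and φ).imp χ) :=
  mp_ctx (trans (log (.pl4 _ _)) h) (log (.pl5 _ _))

theorem swap (h : Prov ax (σ.imp (φ.imp χ))) : Prov ax (φ.imp (σ.imp χ)) :=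
  curry (mp_ctx (trans (log (.pl5 _ _)) h) (log (.pl4 _ _)))

theorem contra (φ χ : SFm) : Prov ax (φ.neg.imp (φ.imp χ)) :=
  curry (trans (uncurry (refl φ.neg)) (log (.pl9 χ)))

theorem allN_intro (h : Prov ax φ) (i : ℕ) : Prov ax (.allN i φ) :=
  .mp (.allRN (ψ := SFm.bot.imp .bot) (weaken h _) (by simp [SFm.fvN]) trivial) (refl _)

theorem exN_elim {c i : ℕ} (hc : φ.bdN ≤ c) (hχ : χ.bdN ≤ c)
    (h : Prov ax ((φ.substN i (.var c)).imp χ)) : Prov ax ((SFm.exN i φ).imp χ) := by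
  have h1 : Prov ax ((SFm.exN c (φ.substN i (.var c))).imp χ) :=
    .exRN h (SFm.notMem_fvN_of_bdN_le hχ) trivial
  have h2 : Prov ax (φ.imp (SFm.exN c (φ.substN i (.var c)))) := by
    have := log (ax := ax)
      (.qa2 c (φ.substN i (.var c)) (.var i) (SFm.freeForN_substN_var i hc))
    rwa [SFm.substN_var_substN i hc] at this
  by_cases hic : c = i
  · subst hic
    rwa [SFm.substN_self] at h1
  · have hi : i ∉ (SFm.exN c (φ.substN i (.var c))).fvN := by
      have : ∀ (t : NTm), i ∉ (t.subst i (.var c)).fv := by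
        intro t
        induction t with
        | var j => by_cases hj : j = i <;> simp [NTm.subst, NTm.fv, hj] <;> omega
        | _ => simp_all [NTm.subst, NTm.fv]
      have : ∀ (ψ : SFm), i ∉ (ψ.substN i (.var c)).fvN := by
        intro ψ
        induction ψ with
        | allN j ψ ih => by_cases hj : j = i <;> simp [SFm.substN, SFm.fvN, hj, ih]
        | exN j ψ ih => by_cases hj : j = i <;> simp [SFm.substN, SFm.fvN, hj, ih]
        | _ => simp_all [SFm.substN, SFm.fvN]
      simp [SFm.fvN, this]
    exact trans (.exRN h2 hi trivial) h1

theorem exS_elim {k c i : ℕ} (hc : φ.bdS ≤ c) (hχ : χ.bdS ≤ c)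
    (h : Prov ax ((φ.substS k i c).imp χ)) : Prov ax ((SFm.exS k i φ).imp χ) := by
  have h1 : Prov ax ((SFm.exS k c (φ.substS k i c)).imp χ) :=
    .exRS h (SFm.notMem_fvS_of_bdS_le hχ) trivial
  have h2 : Prov ax (φ.imp (SFm.exS k c (φ.substS k i c))) := by
    have := log (ax := ax)
      (.qa4 k c i (φ.substS k i c) (SFm.freeForS_substS_var k i hc))
    rwa [SFm.substS_substS_var k i hc] at this
  by_cases hic : c = i
  · subst hic
    rwa [SFm.substS_self] at h1
  · have hi : (k, i) ∉ (SFm.exS k c (φ.substS k i c)).fvS := by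
      have : ∀ (ψ : SFm), (k, i) ∉ (ψ.substS k i c).fvS := by
        intro ψ
        induction ψ with
        | mem k' t j =>
          by_cases hj : k' = k ∧ j = i
          · simp [SFm.substS, SFm.fvS, hj, Ne.symm hic]
          · simp [SFm.substS, SFm.fvS, hj]; omega
        | allS k' j ψ ih =>
          by_cases hj : k' = k ∧ j = i <;> simp [SFm.substS, SFm.fvS, hj, ih]
        | exS k' j ψ ih =>
          by_cases hj : k' = k ∧ j = i <;> simp [SFm.substS, SFm.fvS, hj, ih]
        | _ => simp_all [SFm.substS, SFm.fvS]
      simp [SFm.fvS, this]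
    exact trans (.exRS h2 hi trivial) h1

theorem exN_neg_of_not_allN (i : ℕ) (φ : SFm) :
    Prov ax ((SFm.allN i φ).neg.imp (.exN i φ.neg)) := by
  have h1 : Prov ax (φ.neg.imp (.exN i φ.neg)) := by
    have := log (ax := ax) (.qa2 i φ.neg (.var i) (SFm.freeForN_self _ _))
    rwa [SFm.substN_self] at this
  have h2 : Prov ax ((SFm.exN i φ.neg).neg.imp φ) :=
    trans (curry (mp_ctx (log (.pl4 _ _)) (trans (log (.pl5 _ _)) h1))) (log (.em φ))
  have h3 : Prov ax ((SFm.exN i φ.neg).neg.imp (.allN i φ)) :=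
    .allRN h2 (by simp [SFm.neg, SFm.fvN]) trivial
  exact trans (curry (mp_ctx (log (.pl4 _ _)) (trans (log (.pl5 _ _)) h3))) (log (.em _))

theorem exS_neg_of_not_allS (k i : ℕ) (φ : SFm) :
    Prov ax ((SFm.allS k i φ).neg.imp (.exS k i φ.neg)) := by
  have h1 : Prov ax (φ.neg.imp (.exS k i φ.neg)) := by
    have := log (ax := ax) (.qa4 k i i φ.neg (SFm.freeForS_of_eq_or (.inl rfl)))
    rwa [SFm.substS_self] at this
  have h2 : Prov ax ((SFm.exS k i φ.neg).neg.imp φ) :=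
    trans (curry (mp_ctx (log (.pl4 _ _)) (trans (log (.pl5 _ _)) h1))) (log (.em φ))
  have h3 : Prov ax ((SFm.exS k i φ.neg).neg.imp (.allS k i φ)) :=
    .allRS h2 (by simp [SFm.neg, SFm.fvS]) trivial
  exact trans (curry (mp_ctx (log (.pl4 _ _)) (trans (log (.pl5 _ _)) h3))) (log (.em _))

end Prov

/-! ## Henkin sets -/

/-- A Henkin set: a complete consistent deductively closed set of formulas in which existential
formulas are witnessed by variables of arbitrarily large index. -/
structure Henkin (ax : SFm → Prop) (H : Set SFm) : Prop where
  prov {φ : SFm} : Prov ax φ → φ ∈ H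
  mp {φ ψ : SFm} : φ.imp ψ ∈ H → φ ∈ H → ψ ∈ H
  bot : SFm.bot ∉ H
  compl (φ : SFm) : φ ∈ H ∨ φ.neg ∈ H
  exN_wit {i : ℕ} {φ : SFm} : SFm.exN i φ ∈ H → ∀ N, ∃ c ≥ N, φ.substN i (.var c) ∈ H
  exS_wit {k i : ℕ} {φ : SFm} : SFm.exS k i φ ∈ H → ∀ N, ∃ c ≥ N, φ.substS k i c ∈ H

section Existence

variable {ax : SFm → Prop}

theorem exists_consistent_extension (σ φ : SFm) (N : ℕ) (hσ : ¬ Prov ax (σ.imp .bot)) :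
    ∃ τ : SFm, ¬ Prov ax (τ.imp .bot) ∧ Prov ax (τ.imp σ) ∧
      (Prov ax (τ.imp φ.neg) ∨ (Prov ax (τ.imp φ) ∧
        (∀ i ψ, φ = .exN i ψ → ∃ c ≥ N, Prov ax (τ.imp (ψ.substN i (.var c)))) ∧
        (∀ k i ψ, φ = .exS k i ψ → ∃ c ≥ N, Prov ax (τ.imp (ψ.substS k i c))))) := by
  by_cases hφ : Prov ax ((σ.and φ).imp .bot)
  · exact ⟨σ, hσ, .refl _, .inl (.curry hφ)⟩
  have h4 : Prov ax ((σ.and φ).imp σ) := .log (.pl4 _ _)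
  have h5 : Prov ax ((σ.and φ).imp φ) := .log (.pl5 _ _)
  by_cases hN : ∃ i ψ, φ = .exN i ψ
  · obtain ⟨i, ψ, rfl⟩ := hN
    obtain ⟨c, hc⟩ : ∃ c, N ≤ c ∧ ψ.bdN ≤ c ∧ ((σ.and (.exN i ψ)).imp .bot).bdN ≤ c :=
      ⟨max N (max _ _), le_max_left _ _, (le_max_left _ _).trans (le_max_right _ _),
        (le_max_right _ _).trans (le_max_right _ _)⟩
    refine ⟨(σ.and (.exN i ψ)).and (ψ.substN i (.var c)), fun h => hφ ?_,
      .trans (.log (.pl4 _ _)) h4, .inr ⟨.trans (.log (.pl4 _ _)) h5, ?_, by simp⟩⟩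
    · exact .mp_ctx (.trans h5 (.exN_elim hc.2.1 hc.2.2 (.swap (.curry h)))) (.refl _)
    · rintro _ _ ⟨⟩
      exact ⟨c, hc.1, .log (.pl5 _ _)⟩
  by_cases hS : ∃ k i ψ, φ = .exS k i ψ
  · obtain ⟨k, i, ψ, rfl⟩ := hS
    obtain ⟨c, hc⟩ : ∃ c, N ≤ c ∧ ψ.bdS ≤ c ∧ ((σ.and (.exS k i ψ)).imp .bot).bdS ≤ c :=
      ⟨max N (max _ _), le_max_left _ _, (le_max_left _ _).trans (le_max_right _ _),
        (le_max_right _ _).trans (le_max_right _ _)⟩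
    refine ⟨(σ.and (.exS k i ψ)).and (ψ.substS k i c), fun h => hφ ?_,
      .trans (.log (.pl4 _ _)) h4, .inr ⟨.trans (.log (.pl4 _ _)) h5, by simp, ?_⟩⟩
    · exact .mp_ctx (.trans h5 (.exS_elim hc.2.1 hc.2.2 (.swap (.curry h)))) (.refl _)
    · rintro _ _ _ ⟨⟩
      exact ⟨c, hc.1, .log (.pl5 _ _)⟩
  · exact ⟨σ.and φ, hφ, h4, .inr ⟨h5, fun i ψ h => (hN ⟨i, ψ, h⟩).elim,
      fun k i ψ h => (hS ⟨k, i, ψ, h⟩).elim⟩⟩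

/-- An underivable formula is omitted by some Henkin set. -/
theorem exists_henkin {χ : SFm} (hχ : ¬ Prov ax χ) : ∃ H, Henkin ax H ∧ χ ∉ H := by
  have : Nonempty (SFm × ℕ) := ⟨(χ, 0)⟩
  obtain ⟨e, he⟩ := exists_surjective_nat (SFm × ℕ)
  choose f hf1 hf2 hf3 using
    fun (σ : {σ : SFm // ¬ Prov ax (σ.imp .bot)}) (p : SFm × ℕ) =>
      exists_consistent_extension σ.1 p.1 p.2 σ.2
  have h0 : ¬ Prov ax (χ.neg.imp .bot) := fun h => hχ (.mp (Prov.log (.em χ)) h)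
  let s : ℕ → {σ : SFm // ¬ Prov ax (σ.imp .bot)} :=
    fun n => Nat.rec ⟨χ.neg, h0⟩ (fun n σ => ⟨f σ (e n), hf1 σ (e n)⟩) n
  have hmono : ∀ m n, m ≤ n → Prov ax ((s n).1.imp (s m).1) := by
    intro m n hmn
    induction n, hmn using Nat.le_induction with
    | base => exact .refl _
    | succ n _ ih => exact .trans (hf2 (s n) (e n)) ih
  have hbot : ¬ ∃ n, Prov ax ((s n).1.imp .bot) := fun ⟨n, h⟩ => (s n).2 h
  have hmp : ∀ {φ ψ : SFm}, (∃ n, Prov ax ((s n).1.imp (φ.imp ψ))) →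
      (∃ n, Prov ax ((s n).1.imp φ)) → ∃ n, Prov ax ((s n).1.imp ψ) := by
    rintro φ ψ ⟨m, hm⟩ ⟨n, hn⟩
    exact ⟨max m n, .mp_ctx (.trans (hmono _ _ (le_max_left _ _)) hm)
      (.trans (hmono _ _ (le_max_right _ _)) hn)⟩
  refine ⟨{φ | ∃ n, Prov ax ((s n).1.imp φ)}, ⟨fun h => ⟨0, .weaken h _⟩, hmp, hbot, ?_, ?_, ?_⟩,
    fun h => hbot (hmp ⟨0, .refl _⟩ h)⟩
  · intro φ
    obtain ⟨n, hn⟩ := he (φ, 0)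
    rcases hf3 (s n) (e n) with h | h <;> rw [hn] at h
    · exact .inr ⟨n + 1, by simpa [s, hn] using h⟩
    · exact .inl ⟨n + 1, by simpa [s, hn] using h.1⟩
  · intro i φ hφ N
    obtain ⟨n, hn⟩ := he (.exN i φ, N)
    rcases hf3 (s n) (e n) with h | h <;> rw [hn] at h
    · exact (hbot (hmp ⟨n + 1, by simpa [s, hn, SFm.neg] using h⟩ hφ)).elim
    · obtain ⟨c, hc, h⟩ := h.2.1 i φ rfl
      exact ⟨c, hc, n + 1, by simpa [s, hn] using h⟩
  · intro k i φ hφ N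
    obtain ⟨n, hn⟩ := he (.exS k i φ, N)
    rcases hf3 (s n) (e n) with h | h <;> rw [hn] at h
    · exact (hbot (hmp ⟨n + 1, by simpa [s, hn, SFm.neg] using h⟩ hφ)).elim
    · obtain ⟨c, hc, h⟩ := h.2.2 k i φ rfl
      exact ⟨c, hc, n + 1, by simpa [s, hn] using h⟩

end Existence

namespace Henkin

variable {ax : SFm → Prop} {H : Set SFm} (h : Henkin ax H)
include h

theorem log {φ : SFm} (hφ : SLogAx φ) : φ ∈ H := h.prov (.log hφ)

theorem neg_mem {φ : SFm} : φ.neg ∈ H ↔ φ ∉ H :=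
  ⟨fun h1 h2 => h.bot (h.mp h1 h2), fun h1 => (h.compl φ).resolve_left h1⟩

theorem imp_mem {φ ψ : SFm} : φ.imp ψ ∈ H ↔ (φ ∈ H → ψ ∈ H) := by
  refine ⟨h.mp, fun hi => ?_⟩
  by_cases hφ : φ ∈ H
  · exact h.mp (h.log (.pl1 _ _)) (hi hφ)
  · exact h.mp (h.prov (.contra _ _)) (h.neg_mem.2 hφ)

theorem and_mem {φ ψ : SFm} : φ.and ψ ∈ H ↔ φ ∈ H ∧ ψ ∈ H :=
  ⟨fun hi => ⟨h.mp (h.log (.pl4 _ _)) hi, h.mp (h.log (.pl5 _ _)) hi⟩,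
    fun hi => h.mp (h.mp (h.log (.pl3 _ _)) hi.1) hi.2⟩

theorem or_mem {φ ψ : SFm} : φ.or ψ ∈ H ↔ φ ∈ H ∨ ψ ∈ H := by
  refine ⟨fun hi => ?_, fun hi => hi.elim (h.mp (h.log (.pl6 _ _))) (h.mp (h.log (.pl7 _ _)))⟩
  by_contra! hn
  exact h.bot (h.mp (h.mp (h.mp (h.log (.pl8 φ ψ .bot)) (h.neg_mem.2 hn.1))
    (h.neg_mem.2 hn.2)) hi)

theorem iff_mem {φ ψ : SFm} : φ.iff ψ ∈ H ↔ (φ ∈ H ↔ ψ ∈ H) := by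
  rw [SFm.iff, h.and_mem, h.imp_mem, h.imp_mem]; exact iff_def.symm

theorem allN_inst {i : ℕ} {φ : SFm} (hi : SFm.allN i φ ∈ H) {t : NTm} (ht : φ.freeForN t i) :
    φ.substN i t ∈ H := h.mp (h.log (.qa1 i φ t ht)) hi

theorem allS_inst {k i : ℕ} {φ : SFm} (hi : SFm.allS k i φ ∈ H) {j : ℕ}
    (hj : φ.freeForS k i j) : φ.substS k i j ∈ H := h.mp (h.log (.qa3 k i j φ hj)) hi

theorem exN_intro {i : ℕ} {φ : SFm} {t : NTm} (ht : φ.freeForN t i) (hi : φ.substN i t ∈ H) :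
    SFm.exN i φ ∈ H := h.mp (h.log (.qa2 i φ t ht)) hi

theorem exS_intro {k i j : ℕ} {φ : SFm} (hj : φ.freeForS k i j) (hi : φ.substS k i j ∈ H) :
    SFm.exS k i φ ∈ H := h.mp (h.log (.qa4 k i j φ hj)) hi

theorem allN_intro {i : ℕ} {φ : SFm} (N : ℕ) (hi : ∀ c ≥ N, φ.substN i (.var c) ∈ H) :
    SFm.allN i φ ∈ H := by
  by_contra hn
  obtain ⟨c, hc, hφ⟩ := h.exN_wit (h.mp (h.prov (.exN_neg_of_not_allN i φ)) (h.neg_mem.2 hn)) N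
  exact h.neg_mem.1 hφ (hi c hc)

theorem allS_intro {k i : ℕ} {φ : SFm} (N : ℕ) (hi : ∀ c ≥ N, φ.substS k i c ∈ H) :
    SFm.allS k i φ ∈ H := by
  by_contra hn
  obtain ⟨c, hc, hφ⟩ :=
    h.exS_wit (h.mp (h.prov (.exS_neg_of_not_allS k i φ)) (h.neg_mem.2 hn)) N
  exact h.neg_mem.1 hφ (hi c hc)

end Henkin

/-! ## Arithmetic in a Henkin set -/

namespace Henkin

variable {ax : SFm → Prop} {H : Set SFm} (h : Henkin ax H)
include h

theorem eq_subst {t u : NTm} (htu : SFm.eq t u ∈ H) {i : ℕ} {φ : SFm} (h1 : φ.freeForN t i)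
    (h2 : φ.freeForN u i) (hφ : φ.substN i t ∈ H) : φ.substN i u ∈ H :=
  h.mp (h.mp (h.log (.eqSubst i t u φ h1 h2)) htu) hφ

theorem eq_refl (t : NTm) : SFm.eq t t ∈ H := h.log (.eqRefl t)

theorem eq_subst_eq {t u : NTm} (htu : SFm.eq t u ∈ H) (i : ℕ) (l r : NTm)
    (hlr : SFm.eq (l.subst i t) (r.subst i t) ∈ H) : SFm.eq (l.subst i u) (r.subst i u) ∈ H :=
  h.eq_subst (φ := .eq l r) htu trivial trivial hlr

theorem eq_symm {t u : NTm} (htu : SFm.eq t u ∈ H) : SFm.eq u t ∈ H := by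
  have hi u := NTm.subst_of_notMem u (NTm.notMem_fv_of_maxVar_le (le_refl t.maxVar))
  simpa [hi, NTm.subst] using
    h.eq_subst_eq htu t.maxVar (.var t.maxVar) t (by simpa [hi, NTm.subst] using h.eq_refl t)

theorem eq_trans {s t u : NTm} (hst : SFm.eq s t ∈ H) (htu : SFm.eq t u ∈ H) :
    SFm.eq s u ∈ H := by
  have hi u := NTm.subst_of_notMem u (NTm.notMem_fv_of_maxVar_le (le_refl s.maxVar))
  simpa [hi, NTm.subst] using
    h.eq_subst_eq htu s.maxVar s (.var s.maxVar) (by simpa [hi, NTm.subst] using hst)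

theorem eq_congr {t u : NTm} (htu : SFm.eq t u ∈ H) (i : ℕ) (l : NTm) :
    SFm.eq (l.subst i t) (l.subst i u) ∈ H := by
  obtain ⟨j, hj1, hj2⟩ : ∃ j, l.maxVar ≤ j ∧ (l.subst i t).maxVar ≤ j :=
    ⟨max _ _, le_max_left _ _, le_max_right _ _⟩
  have hj u := NTm.subst_of_notMem u (NTm.notMem_fv_of_maxVar_le hj2)
  have hl u := NTm.subst_var_subst i u (NTm.notMem_fv_of_maxVar_le hj1)
  have := h.eq_subst_eq htu j (l.subst i t) (l.subst i (.var j)) (by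
    rw [hj, hl]; exact h.eq_refl _)
  rwa [hj, hl] at this

theorem add_congr {t t' u u' : NTm} (ht : SFm.eq t t' ∈ H) (hu : SFm.eq u u' ∈ H) :
    SFm.eq (t.add u) (t'.add u') ∈ H := by
  have h1 := h.eq_congr ht u.maxVar ((NTm.var u.maxVar).add u)
  have h2 := h.eq_congr hu t'.maxVar (t'.add (.var t'.maxVar))
  simp only [NTm.subst, if_true,
    NTm.subst_of_notMem _ (NTm.notMem_fv_of_maxVar_le (le_refl (NTm.maxVar _)))] at h1 h2
  exact h.eq_trans h1 h2

theorem mul_congr {t t' u u' : NTm} (ht : SFm.eq t t' ∈ H) (hu : SFm.eq u u' ∈ H) :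
    SFm.eq (t.mul u) (t'.mul u') ∈ H := by
  have h1 := h.eq_congr ht u.maxVar ((NTm.var u.maxVar).mul u)
  have h2 := h.eq_congr hu t'.maxVar (t'.mul (.var t'.maxVar))
  simp only [NTm.subst, if_true,
    NTm.subst_of_notMem _ (NTm.notMem_fv_of_maxVar_le (le_refl (NTm.maxVar _)))] at h1 h2
  exact h.eq_trans h1 h2

theorem mem_congr {t u : NTm} (htu : SFm.eq t u ∈ H) {k i : ℕ} :
    SFm.mem k t i ∈ H ↔ SFm.mem k u i ∈ H :=
  ⟨h.eq_subst (i := 0) (φ := .mem k (.var 0) i) htu trivial trivial,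
    h.eq_subst (i := 0) (φ := .mem k (.var 0) i) (h.eq_symm htu) trivial trivial⟩

/-- Provable equality of terms. -/
def setoid : Setoid NTm where
  r t u := SFm.eq t u ∈ H
  iseqv := ⟨h.eq_refl, h.eq_symm, h.eq_trans⟩

/-- The numbers of a Henkin set: terms modulo provable equality. -/
def Num : Type := Quotient h.setoid

/-- The number denoted by a term. -/
def num (t : NTm) : h.Num := Quotient.mk h.setoid t

theorem eq_mem {t u : NTm} : SFm.eq t u ∈ H ↔ h.num t = h.num u :=
  (Quotient.eq (r := h.setoid)).symm

instance : Zero h.Num := ⟨h.num .zero⟩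
instance : One h.Num := ⟨h.num .one⟩
instance : Add h.Num :=
  ⟨Quotient.map₂ (sa := h.setoid) (sb := h.setoid) (sc := h.setoid) NTm.add
    fun _ _ ha _ _ hb => h.add_congr ha hb⟩
instance : Mul h.Num :=
  ⟨Quotient.map₂ (sa := h.setoid) (sb := h.setoid) (sc := h.setoid) NTm.mul
    fun _ _ ha _ _ hb => h.mul_congr ha hb⟩

@[simp] theorem num_zero : h.num .zero = 0 := rfl
@[simp] theorem num_one : h.num .one = 1 := rfl
@[simp] theorem num_add (t u : NTm) : h.num (t.add u) = h.num t + h.num u := rfl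
@[simp] theorem num_mul (t u : NTm) : h.num (t.mul u) = h.num t * h.num u := rfl

theorem exists_num (x : h.Num) : ∃ t, h.num t = x := Quotient.exists_rep x

theorem exists_var (x : h.Num) (N : ℕ) : ∃ c ≥ N, h.num (.var c) = x := by
  obtain ⟨t, rfl⟩ := h.exists_num x
  have h1 : SFm.exN t.maxVar (.eq (.var t.maxVar) t) ∈ H := by
    refine h.exN_intro (t := t) trivial ?_
    simpa [SFm.substN, NTm.subst, NTm.subst_of_notMem _
      (NTm.notMem_fv_of_maxVar_le (le_refl t.maxVar))] using h.eq_refl t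
  obtain ⟨c, hc, h2⟩ := h.exN_wit h1 N
  refine ⟨c, hc, h.eq_mem.1 ?_⟩
  simpa [SFm.substN, NTm.subst, NTm.subst_of_notMem _
      (NTm.notMem_fv_of_maxVar_le (le_refl t.maxVar))] using h2

/-- An existentially quantified equation holds iff it is solvable. -/
theorem exN_eq_mem {d : ℕ} {l r : NTm} : SFm.exN d (.eq l r) ∈ H ↔
    ∃ t, h.num (l.subst d t) = h.num (r.subst d t) :=
  ⟨fun hd => let ⟨c, _, hc⟩ := h.exN_wit hd 0; ⟨.var c, h.eq_mem.1 hc⟩,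
    fun ⟨_, ht⟩ => h.exN_intro trivial (h.eq_mem.2 ht)⟩

/-- Induction for definable predicates. -/
theorem induct (hax : ∀ (φ : SFm) (i : ℕ), ax (((φ.substN i .zero).and
      (.allN i (φ.imp (φ.substN i (.add (.var i) .one))))).imp (.allN i φ)))
    (φ : SFm) (i N : ℕ) (Q : h.Num → Prop)
    (hQ : ∀ t : NTm, (∀ v ∈ t.fv, N ≤ v) → (φ.substN i t ∈ H ↔ Q (h.num t)))
    (h0 : Q 0) (h1 : ∀ x, Q x → Q (x + 1)) (x : h.Num) : Q x := by
  have key : SFm.allN i φ ∈ H := by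
    refine h.mp (h.prov (.extra (hax φ i) trivial)) (h.and_mem.2 ⟨?_, h.allN_intro N ?_⟩)
    · exact (hQ .zero (by simp [NTm.fv])).2 h0
    · intro c hc
      simp only [SFm.substN]
      rw [h.imp_mem, SFm.substN_substN_self, hQ (.var c) (by simpa [NTm.fv] using hc)]
      intro hx
      refine (hQ _ ?_).2 (by simpa [NTm.subst] using h1 _ hx)
      simpa [NTm.subst, NTm.fv] using hc
  obtain ⟨c, hc, rfl⟩ := h.exists_var x (max N φ.bdN)
  exact (hQ (.var c) (by simp [NTm.fv]; omega)).1
    (h.allN_inst key (SFm.freeForN_var (by omega)))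

/-- Induction for equations between terms. -/
theorem induct_eq (hax : ∀ (φ : SFm) (i : ℕ), ax (((φ.substN i .zero).and
      (.allN i (φ.imp (φ.substN i (.add (.var i) .one))))).imp (.allN i φ)))
    (l r : NTm) (i : ℕ) (f g : h.Num → h.Num)
    (hf : ∀ t, h.num (l.subst i t) = f (h.num t)) (hg : ∀ t, h.num (r.subst i t) = g (h.num t))
    (h0 : f 0 = g 0) (h1 : ∀ x, f x = g x → f (x + 1) = g (x + 1)) (x : h.Num) : f x = g x :=
  h.induct hax (.eq l r) i 0 (fun x => f x = g x)
    (fun t _ => by rw [← hf, ← hg]; exact h.eq_mem) h0 h1 x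

section Peano

variable (hP : ∀ α, PeanoAx α → ax α.toS)
include hP

theorem peano_inst {α : AFm} (hα : PeanoAx α) (a b : ℕ) (ha : 2 ≤ a) :
    ((α.toS.substN 0 (.var a)).substN 1 (.var b)) ∈ H := by
  have hb : α.toS.bdN ≤ 2 ∧ ∀ t, (α.toS.substN 0 (.var a)).freeForN t 1 := by
    cases hα <;> simp [AFm.toS, AFm.neg, SFm.bdN, NTm.maxVar, SFm.substN, SFm.freeForN]
  refine h.allN_inst ?_ (hb.2 _)
  have h1 : SFm.allN 0 (.allN 1 α.toS) ∈ H :=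
    h.prov (.allN_intro (.allN_intro (.extra (hP α hα) trivial) 1) 0)
  have := h.allN_inst h1 (t := .var a) (SFm.freeForN_var (by
    simp only [SFm.bdN]; have := hb.1; omega))
  simpa [SFm.substN] using this

theorem succ_ne_zero (x : h.Num) : x + 1 ≠ 0 := by
  obtain ⟨a, ha, rfl⟩ := h.exists_var x 2
  have := h.peano_inst hP .succ_ne_zero a a ha
  have ha1 : a ≠ 1 := by omega
  simp only [AFm.toS, AFm.neg, SFm.substN, NTm.subst, if_true, ha1, if_false, h.imp_mem,
    h.eq_mem] at this
  exact fun hx => h.bot (this hx)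

theorem succ_inj (x y : h.Num) (hxy : x + 1 = y + 1) : x = y := by
  obtain ⟨a, ha, rfl⟩ := h.exists_var x 2
  obtain ⟨b, hb, rfl⟩ := h.exists_var y 2
  have := h.peano_inst hP .succ_inj a b ha
  have ha1 : a ≠ 1 := by omega
  simp [AFm.toS, SFm.substN, NTm.subst, ha1, h.imp_mem, h.eq_mem] at this
  exact this hxy

theorem add_zero' (x : h.Num) : x + 0 = x := by
  obtain ⟨a, ha, rfl⟩ := h.exists_var x 2
  have := h.peano_inst hP .add_zero a a ha
  have ha1 : a ≠ 1 := by omega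
  simpa [AFm.toS, SFm.substN, NTm.subst, ha1, h.eq_mem] using this

theorem add_succ' (x y : h.Num) : x + (y + 1) = x + y + 1 := by
  obtain ⟨a, ha, rfl⟩ := h.exists_var x 2
  obtain ⟨b, hb, rfl⟩ := h.exists_var y 2
  have := h.peano_inst hP .add_succ a b ha
  have ha1 : a ≠ 1 := by omega
  simpa [AFm.toS, SFm.substN, NTm.subst, ha1, h.eq_mem] using this

theorem mul_zero' (x : h.Num) : x * 0 = 0 := by
  obtain ⟨a, ha, rfl⟩ := h.exists_var x 2
  have := h.peano_inst hP .mul_zero a a ha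
  have ha1 : a ≠ 1 := by omega
  simpa [AFm.toS, SFm.substN, NTm.subst, ha1, h.eq_mem] using this

theorem mul_succ' (x y : h.Num) : x * (y + 1) = x * y + x := by
  obtain ⟨a, ha, rfl⟩ := h.exists_var x 2
  obtain ⟨b, hb, rfl⟩ := h.exists_var y 2
  have := h.peano_inst hP .mul_succ a b ha
  have ha1 : a ≠ 1 := by omega
  simpa [AFm.toS, SFm.substN, NTm.subst, ha1, h.eq_mem] using this

end Peano

end Henkin

/-- `ax` contains the Peano axioms and the induction scheme. -/
structure ArithAx (ax : SFm → Prop) : Prop where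
  peano (α : AFm) : PeanoAx α → ax α.toS
  ind (φ : SFm) (i : ℕ) : ax (((φ.substN i .zero).and
      (.allN i (φ.imp (φ.substN i (.add (.var i) .one))))).imp (.allN i φ))

namespace Henkin

variable {ax : SFm → Prop} {H : Set SFm} (h : Henkin ax H) (hA : ArithAx ax)
include hA

theorem zero_add' (x : h.Num) : 0 + x = x :=
  h.induct_eq hA.ind (.add .zero (.var 0)) (.var 0) 0 (fun x => 0 + x) (fun x => x)
    (fun _ => rfl) (fun _ => rfl) (h.add_zero' hA.peano 0)
    (fun x hx => by simp only [h.add_succ' hA.peano, hx]) x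

theorem succ_add' (y x : h.Num) : (y + 1) + x = y + x + 1 := by
  obtain ⟨a, ha, rfl⟩ := h.exists_var y 1
  have ha0 : a ≠ 0 := by omega
  exact h.induct_eq hA.ind (.add (.add (.var a) .one) (.var 0)) (.add (.add (.var a) (.var 0)) .one)
    0 (fun x => h.num (.var a) + 1 + x) (fun x => h.num (.var a) + x + 1)
    (fun _ => by simp [NTm.subst, ha0]) (fun _ => by simp [NTm.subst, ha0])
    (by simp only [h.add_zero' hA.peano])
    (fun x hx => by simp only [h.add_succ' hA.peano, hx]) x

theorem add_comm' (y x : h.Num) : y + x = x + y := by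
  obtain ⟨a, ha, rfl⟩ := h.exists_var y 1
  have ha0 : a ≠ 0 := by omega
  exact h.induct_eq hA.ind (.add (.var a) (.var 0)) (.add (.var 0) (.var a))
    0 (fun x => h.num (.var a) + x) (fun x => x + h.num (.var a))
    (fun _ => by simp [NTm.subst, ha0]) (fun _ => by simp [NTm.subst, ha0])
    (by simp only [h.add_zero' hA.peano, h.zero_add' hA])
    (fun x hx => by simp only [h.add_succ' hA.peano, h.succ_add' hA, hx]) x

theorem add_assoc' (y z x : h.Num) : y + z + x = y + (z + x) := by
  obtain ⟨a, ha, rfl⟩ := h.exists_var y 1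
  obtain ⟨b, hb, rfl⟩ := h.exists_var z 1
  have ha0 : a ≠ 0 := by omega
  have hb0 : b ≠ 0 := by omega
  exact h.induct_eq hA.ind (.add (.add (.var a) (.var b)) (.var 0))
    (.add (.var a) (.add (.var b) (.var 0)))
    0 (fun x => h.num (.var a) + h.num (.var b) + x)
    (fun x => h.num (.var a) + (h.num (.var b) + x))
    (fun _ => by simp [NTm.subst, ha0, hb0]) (fun _ => by simp [NTm.subst, ha0, hb0])
    (by simp only [h.add_zero' hA.peano])
    (fun x hx => by simp only [h.add_succ' hA.peano, hx]) x

theorem zero_mul' (x : h.Num) : 0 * x = 0 :=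
  h.induct_eq hA.ind (.mul .zero (.var 0)) .zero 0 (fun x => 0 * x) (fun _ => 0)
    (fun _ => rfl) (fun _ => rfl) (h.mul_zero' hA.peano 0)
    (fun x hx => by simp only [h.mul_succ' hA.peano, hx, h.add_zero' hA.peano]) x

theorem succ_mul' (y x : h.Num) : (y + 1) * x = y * x + x := by
  obtain ⟨a, ha, rfl⟩ := h.exists_var y 1
  have ha0 : a ≠ 0 := by omega
  refine h.induct_eq hA.ind (.mul (.add (.var a) .one) (.var 0))
    (.add (.mul (.var a) (.var 0)) (.var 0))
    0 (fun x => (h.num (.var a) + 1) * x) (fun x => h.num (.var a) * x + x)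
    (fun _ => by simp [NTm.subst, ha0]) (fun _ => by simp [NTm.subst, ha0])
    (by simp only [h.mul_zero' hA.peano, h.add_zero' hA.peano])
    (fun x hx => ?_) x
  simp only [h.mul_succ' hA.peano]
  generalize h.num (.var a) = y at *
  rw [hx, h.add_succ' hA.peano, h.add_succ' hA.peano, h.add_assoc' hA (y * x) x y,
    h.add_assoc' hA (y * x) y x, h.add_comm' hA x y]

theorem mul_comm' (y x : h.Num) : y * x = x * y := by
  obtain ⟨a, ha, rfl⟩ := h.exists_var y 1
  have ha0 : a ≠ 0 := by omega
  exact h.induct_eq hA.ind (.mul (.var a) (.var 0)) (.mul (.var 0) (.var a))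
    0 (fun x => h.num (.var a) * x) (fun x => x * h.num (.var a))
    (fun _ => by simp [NTm.subst, ha0]) (fun _ => by simp [NTm.subst, ha0])
    (by simp only [h.mul_zero' hA.peano, h.zero_mul' hA])
    (fun x hx => by simp only [h.mul_succ' hA.peano, h.succ_mul' hA, hx]) x

theorem mul_add' (y z x : h.Num) : y * (z + x) = y * z + y * x := by
  obtain ⟨a, ha, rfl⟩ := h.exists_var y 1
  obtain ⟨b, hb, rfl⟩ := h.exists_var z 1
  have ha0 : a ≠ 0 := by omega
  have hb0 : b ≠ 0 := by omega
  exact h.induct_eq hA.ind (.mul (.var a) (.add (.var b) (.var 0)))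
    (.add (.mul (.var a) (.var b)) (.mul (.var a) (.var 0)))
    0 (fun x => h.num (.var a) * (h.num (.var b) + x))
    (fun x => h.num (.var a) * h.num (.var b) + h.num (.var a) * x)
    (fun _ => by simp [NTm.subst, ha0, hb0]) (fun _ => by simp [NTm.subst, ha0, hb0])
    (by simp only [h.mul_zero' hA.peano, h.add_zero' hA.peano])
    (fun x hx => by
      simp only [h.add_succ' hA.peano, h.mul_succ' hA.peano, hx]
      rw [h.add_assoc' hA]) x

theorem mul_assoc' (y z x : h.Num) : y * z * x = y * (z * x) := by
  obtain ⟨a, ha, rfl⟩ := h.exists_var y 1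
  obtain ⟨b, hb, rfl⟩ := h.exists_var z 1
  have ha0 : a ≠ 0 := by omega
  have hb0 : b ≠ 0 := by omega
  exact h.induct_eq hA.ind (.mul (.mul (.var a) (.var b)) (.var 0))
    (.mul (.var a) (.mul (.var b) (.var 0)))
    0 (fun x => h.num (.var a) * h.num (.var b) * x)
    (fun x => h.num (.var a) * (h.num (.var b) * x))
    (fun _ => by simp [NTm.subst, ha0, hb0]) (fun _ => by simp [NTm.subst, ha0, hb0])
    (by simp only [h.mul_zero' hA.peano])
    (fun x hx => by simp only [h.mul_succ' hA.peano, h.mul_add' hA, hx]) x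

/-- The numbers of a Henkin set form a commutative semiring. -/
@[reducible] def commSemiring : CommSemiring h.Num where
  add_assoc := h.add_assoc' hA
  zero_add := h.zero_add' hA
  add_zero := h.add_zero' hA.peano
  add_comm := h.add_comm' hA
  nsmul := nsmulRec
  mul_assoc := h.mul_assoc' hA
  one_mul x := by
    have := h.succ_mul' hA 0 x
    rwa [h.zero_add' hA, h.zero_mul' hA, h.zero_add' hA] at this
  mul_one x := by
    have := h.mul_succ' hA.peano x 0
    rwa [h.zero_add' hA, h.mul_zero' hA.peano, h.zero_add' hA] at this
  zero_mul := h.zero_mul' hA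
  mul_zero := h.mul_zero' hA.peano
  left_distrib := h.mul_add' hA
  right_distrib x y z := by simp only [h.mul_comm' hA _ z, h.mul_add' hA]
  mul_comm := h.mul_comm' hA

theorem add_right_cancel' (y z x : h.Num) : y + x = z + x → y = z := by
  obtain ⟨a, ha, rfl⟩ := h.exists_var y 1
  obtain ⟨b, hb, rfl⟩ := h.exists_var z 1
  have ha0 : a ≠ 0 := by omega
  have hb0 : b ≠ 0 := by omega
  refine h.induct hA.ind ((SFm.eq (.add (.var a) (.var 0)) (.add (.var b) (.var 0))).imp
    (.eq (.var a) (.var b))) 0 0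
    (fun x => h.num (.var a) + x = h.num (.var b) + x → h.num (.var a) = h.num (.var b))
    (fun t _ => by simp [SFm.substN, NTm.subst, ha0, hb0, h.imp_mem, h.eq_mem]) ?_ ?_ x
  · simp only [h.add_zero' hA.peano]; exact id
  · intro x hx hs
    simp only [h.add_succ' hA.peano] at hs
    exact hx (h.succ_inj hA.peano _ _ hs)

theorem eq_zero_or_succ (x : h.Num) : x = 0 ∨ ∃ y, x = y + 1 := by
  refine h.induct hA.ind ((SFm.eq (.var 0) .zero).or
    (.exN 1 (.eq (.var 0) (.add (.var 1) .one)))) 0 2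
    (fun x => x = 0 ∨ ∃ y, x = y + 1) (fun t ht => ?_) (.inl rfl) (fun x _ => .inr ⟨x, rfl⟩) x
  have h1 : ∀ u, t.subst 1 u = t := fun u => NTm.subst_of_notMem u fun hm => by
    have := ht 1 hm; omega
  simp [SFm.substN, NTm.subst, h.or_mem, h.eq_mem, h.exN_eq_mem, h1]
  exact or_congr_right ⟨fun ⟨u, hu⟩ => ⟨_, hu⟩, fun ⟨y, hy⟩ => by
    obtain ⟨u, rfl⟩ := h.exists_num y; exact ⟨u, hy⟩⟩

theorem le_total (z x : h.Num) : (∃ d, x + d = z) ∨ ∃ d, z + d = x := by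
  obtain ⟨b, hb, rfl⟩ := h.exists_var z 2
  have hb0 : b ≠ 0 := by omega
  have hb1 : b ≠ 1 := by omega
  refine h.induct hA.ind ((SFm.exN 1 (.eq (.add (.var 0) (.var 1)) (.var b))).or
    (.exN 1 (.eq (.add (.var b) (.var 1)) (.var 0)))) 0 2
    (fun x => (∃ d, x + d = h.num (.var b)) ∨ ∃ d, h.num (.var b) + d = x) (fun t ht => ?_)
    (.inl ⟨_, h.zero_add' hA _⟩) ?_ x
  · have h1 : ∀ u, t.subst 1 u = t := fun u => NTm.subst_of_notMem u fun hm => by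
      have := ht 1 hm; omega
    simp [SFm.substN, NTm.subst, h.or_mem, h.exN_eq_mem, h1, hb0, hb1]
    refine or_congr ⟨fun ⟨u, hu⟩ => ⟨_, hu⟩, fun ⟨y, hy⟩ => ?_⟩
      ⟨fun ⟨u, hu⟩ => ⟨_, hu⟩, fun ⟨y, hy⟩ => ?_⟩ <;>
    · obtain ⟨u, rfl⟩ := h.exists_num y
      exact ⟨u, hy⟩
  · rintro x (⟨d, hd⟩ | ⟨d, hd⟩)
    · rcases h.eq_zero_or_succ hA d with rfl | ⟨e, rfl⟩
      · exact .inr ⟨1, by rw [← hd, h.add_zero' hA.peano]⟩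
      · exact .inl ⟨e, by rw [← hd, h.succ_add' hA, h.add_succ' hA.peano]⟩
    · exact .inr ⟨d + 1, by rw [h.add_succ' hA.peano, hd]⟩

theorem exists_half (x : h.Num) : ∃ y, y + y = x * (x + 1) := by
  refine h.induct hA.ind (SFm.exN 1 (.eq (.add (.var 1) (.var 1))
    (.mul (.var 0) (.add (.var 0) .one)))) 0 2
    (fun x => ∃ y, y + y = x * (x + 1)) (fun t ht => ?_)
    ⟨0, by rw [h.zero_mul' hA, h.add_zero' hA.peano]⟩ ?_ x
  · have h1 : ∀ u, t.subst 1 u = t := fun u => NTm.subst_of_notMem u fun hm => by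
      have := ht 1 hm; omega
    simp [SFm.substN, NTm.subst, h.exN_eq_mem, h1]
    refine ⟨fun ⟨u, hu⟩ => ⟨_, hu⟩, fun ⟨y, hy⟩ => ?_⟩
    obtain ⟨u, rfl⟩ := h.exists_num y
    exact ⟨u, hy⟩
  · rintro x ⟨y, hy⟩
    let _ := h.commSemiring hA
    refine ⟨y + (x + 1), ?_⟩
    calc y + (x + 1) + (y + (x + 1)) = (y + y) + 2 * (x + 1) := by ring
      _ = _ := by rw [hy]; ring

/-- The relation `p = (n, m)` between numbers. -/
def IsPair (p n m : h.Num) : Prop :=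
  p + p = (n + m) * (n + m + 1) + (m + m)

omit hA in
theorem pairEq_mem {p n m : NTm} :
    pairEq p n m ∈ H ↔ h.IsPair (h.num p) (h.num n) (h.num m) := h.eq_mem

theorem exists_isPair (n m : h.Num) : ∃ p, h.IsPair p n m := by
  let _ := h.commSemiring hA
  obtain ⟨y, hy⟩ := h.exists_half hA (n + m)
  refine ⟨y + m, ?_⟩
  rw [IsPair, ← hy]
  ring

theorem isPair_inj {p n m n' m' : h.Num} (h1 : h.IsPair p n m) (h2 : h.IsPair p n' m') :
    n = n' ∧ m = m' := by
  let _ := h.commSemiring hA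
  have hlt : ∀ n m n' m' d : h.Num, n + m + (d + 1) = n' + m' →
      (n + m) * (n + m + 1) + (m + m) ≠ (n' + m') * (n' + m' + 1) + (m' + m') := by
    intro n m n' m' d hd he
    rw [← hd] at he
    refine h.succ_ne_zero hA.peano (2 * n + 2 * (n + m) * d + d * d + 3 * d + 1 + 2 * m')
      (h.add_right_cancel' hA _ _ ((n + m) * (n + m + 1) + (m + m)) ?_)
    rw [zero_add]
    calc _ = (n + m + (d + 1)) * (n + m + (d + 1) + 1) + (m' + m') := by ring
      _ = _ := he.symm
  have h0 : ∀ d : h.Num, d + d = 0 → d = 0 := by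
    intro d hd
    rcases h.eq_zero_or_succ hA d with rfl | ⟨e, rfl⟩
    · rfl
    · exact (h.succ_ne_zero hA.peano (e + 1 + e) (by rw [add_assoc, hd])).elim
  have hs : n + m = n' + m' := by
    rcases h.le_total hA (n' + m') (n + m) with ⟨d, hd⟩ | ⟨d, hd⟩ <;>
      rcases h.eq_zero_or_succ hA d with rfl | ⟨e, rfl⟩
    · rwa [add_zero] at hd
    · exact (hlt _ _ _ _ e hd (h1.symm.trans h2)).elim
    · rw [add_zero] at hd
      exact hd.symm
    · exact (hlt _ _ _ _ e hd (h2.symm.trans h1)).elim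
  have hmm : m + m = m' + m' := by
    have := h1.symm.trans h2
    rw [hs, add_comm _ (m + m), add_comm _ (m' + m')] at this
    exact h.add_right_cancel' hA _ _ _ this
  have hc : ∀ m d : h.Num, m + m = (m + d) + (m + d) → d = 0 := by
    intro m d hd
    refine h0 d (h.add_right_cancel' hA _ _ (m + m) ?_)
    rw [zero_add]
    exact (by ring : d + d + (m + m) = m + d + (m + d)).trans hd.symm
  have hm : m = m' := by
    rcases h.le_total hA m' m with ⟨d, rfl⟩ | ⟨d, rfl⟩
    · rw [hc m d hmm, add_zero]
    · rw [hc m' d hmm.symm, add_zero]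
  exact ⟨h.add_right_cancel' hA _ _ m (by rw [hs, hm]), hm⟩

end Henkin

namespace SFm

theorem freeForS_of_noSetQ {φ : SFm} (hφ : φ.noSetQ) (k i j : ℕ) : φ.freeForS k i j := by
  induction φ <;> simp_all [noSetQ, freeForS]

theorem noSetQ_substN {φ : SFm} (i : ℕ) (t : NTm) : (φ.substN i t).noSetQ ↔ φ.noSetQ := by
  induction φ with
  | allN j φ ih => by_cases hj : j = i <;> simp [substN, noSetQ, hj, ih]
  | exN j φ ih => by_cases hj : j = i <;> simp [substN, noSetQ, hj, ih]
  | _ => simp_all [noSetQ, substN]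

theorem noSetQ_substS {φ : SFm} (k i j : ℕ) : (φ.substS k i j).noSetQ ↔ φ.noSetQ := by
  induction φ with
  | mem k' t l => by_cases hl : k' = k ∧ l = i <;> simp [substS, noSetQ, hl]
  | allS k' l φ ih => by_cases hl : k' = k ∧ l = i <;> simp [substS, noSetQ, hl]
  | exS k' l φ ih => by_cases hl : k' = k ∧ l = i <;> simp [substS, noSetQ, hl]
  | _ => simp_all [noSetQ, substS]

theorem notMem_fvN_substN {φ : SFm} {v : ℕ} (hv : v ∉ φ.fvN) (i : ℕ) {t : NTm} (ht : v ∉ t.fv) :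
    v ∉ (φ.substN i t).fvN := by
  have hs : ∀ s : NTm, v ∉ s.fv → v ∉ (s.subst i t).fv := by
    intro s hs
    induction s with
    | var j => by_cases hj : j = i <;> simp_all [NTm.subst, NTm.fv]
    | _ => simp_all [NTm.subst, NTm.fv]
  induction φ with
  | eq a b =>
    simp only [fvN, Finset.mem_union, not_or] at hv
    simp [substN, fvN, hs _ hv.1, hs _ hv.2]
  | mem k a j => exact hs _ hv
  | allN j φ ih | exN j φ ih =>
    by_cases hj : j = i
    · simpa [substN, hj] using hv
    · simp only [substN, hj, if_false, fvN, Finset.mem_erase] at *; tauto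
  | _ => simp_all [substN, fvN]

theorem pairEq_substN (p n m : NTm) (i : ℕ) (t : NTm) :
    (pairEq p n m).substN i t = pairEq (p.subst i t) (n.subst i t) (m.subst i t) := rfl

theorem pairEq_substS (p n m : NTm) (k i j : ℕ) :
    (pairEq p n m).substS k i j = pairEq p n m := rfl

end SFm

/-! ## Choice in a Henkin set -/

namespace Henkin

variable {ax : SFm → Prop} {H : Set SFm} (h : Henkin ax H)
include h

theorem exN_iff {i : ℕ} {φ : SFm} (N : ℕ) (Q : h.Num → Prop)
    (hQ : ∀ c ≥ N, φ.substN i (.var c) ∈ H ↔ Q (h.num (.var c))) :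
    SFm.exN i φ ∈ H ↔ ∃ x, Q x := by
  constructor
  · intro hi
    obtain ⟨c, hc, hφ⟩ := h.exN_wit hi N
    exact ⟨_, (hQ c hc).1 hφ⟩
  · rintro ⟨x, hx⟩
    obtain ⟨c, hc, rfl⟩ := h.exists_var x (max N φ.bdN)
    exact h.exN_intro (SFm.freeForN_var (by omega)) ((hQ c (by omega)).2 hx)

theorem allN_iff {i : ℕ} {φ : SFm} (N : ℕ) (Q : h.Num → Prop)
    (hQ : ∀ c ≥ N, φ.substN i (.var c) ∈ H ↔ Q (h.num (.var c))) :
    SFm.allN i φ ∈ H ↔ ∀ x, Q x := by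
  constructor
  · intro hi x
    obtain ⟨c, hc, rfl⟩ := h.exists_var x (max N φ.bdN)
    exact (hQ c (by omega)).1 (h.allN_inst hi (SFm.freeForN_var (by omega)))
  · intro hi
    exact h.allN_intro N fun c hc => (hQ c hc).2 (hi _)

theorem exS_iff {k i : ℕ} {φ : SFm} (hφ : φ.noSetQ) :
    SFm.exS k i φ ∈ H ↔ ∃ c, φ.substS k i c ∈ H :=
  ⟨fun hi => let ⟨c, _, hc⟩ := h.exS_wit hi 0; ⟨c, hc⟩,
    fun ⟨_, hc⟩ => h.exS_intro (SFm.freeForS_of_noSetQ hφ _ _ _) hc⟩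

theorem allS_iff {k i : ℕ} {φ : SFm} (hφ : φ.noSetQ) :
    SFm.allS k i φ ∈ H ↔ ∀ c, φ.substS k i c ∈ H :=
  ⟨fun hi _ => h.allS_inst hi (SFm.freeForS_of_noSetQ hφ _ _ _),
    fun hi => h.allS_intro 0 fun c _ => hi c⟩

theorem exists_pred (φ : SFm) (i : ℕ) : ∃ Q : h.Num → Prop,
    ∀ c ≥ φ.bdN, φ.substN i (.var c) ∈ H ↔ Q (h.num (.var c)) := by
  refine ⟨fun x => ∃ c ≥ φ.bdN, h.num (.var c) = x ∧ φ.substN i (.var c) ∈ H,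
    fun c hc => ⟨fun hφ => ⟨c, hc, rfl, hφ⟩, ?_⟩⟩
  rintro ⟨d, hd, hcd, hφ⟩
  exact h.eq_subst (h.eq_mem.2 hcd) (SFm.freeForN_var hd) (SFm.freeForN_var hc) hφ

/-- Membership of numbers in the sets named by set variables. -/
def Mem (k i : ℕ) (x : h.Num) : Prop := ∃ t, h.num t = x ∧ SFm.mem k t i ∈ H

theorem mem_mem {k i : ℕ} {t : NTm} : SFm.mem k t i ∈ H ↔ h.Mem k i (h.num t) :=
  ⟨fun ht => ⟨t, rfl, ht⟩, fun ⟨_, hu, hm⟩ => (h.mem_congr (h.eq_mem.2 hu)).1 hm⟩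

theorem choice_of_deltaC (hA : ArithAx ax) {k : ℕ}
    (hD : ∀ (φ ψ : SFm) (n i z : ℕ), φ.noSetQ → ψ.noSetQ →
      (k + 1, z) ∉ φ.fvS → (k + 1, z) ∉ ψ.fvS →
      ax ((SFm.allN n ((SFm.allS k i φ).iff (.exS k i ψ))).imp
        (.exS (k + 1) z (.allN n ((SFm.mem (k + 1) (.var n) z).iff (.exS k i ψ))))))
    {φ : SFm} {n ix iz iy q m p : ℕ} (hφ : φ.simple k)
    (hiz : (k, iz) ∉ φ.fvS) (hizx : iz ≠ ix)
    (hq : q ∉ φ.fvN ∧ q ≠ n) (hm : m ∉ φ.fvN ∧ m ≠ n) (hp : p ∉ φ.fvN ∧ p ≠ n ∧ p ≠ m)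
    (hH : SFm.allN n (.exS k ix (φ.and (.allS k iz ((φ.substS k ix iz).imp
      (.allN q ((SFm.mem k (.var q) ix).iff (.mem k (.var q) iz))))))) ∈ H) :
    SFm.exS (k + 1) iy (.allN n (.exS k ix (φ.and
      (.allN m ((SFm.mem k (.var m) ix).iff
        (pairMem (k + 1) (.var n) (.var m) iy p)))))) ∈ H := by
  have hφ' := hφ.noSetQ
  have hiy : (k + 1, iy) ∉ φ.fvS := fun hy => by have := hφ.sort_le hy; omega
  choose P hP using fun X => h.exists_pred (φ.substS k ix X) n
  simp only [SFm.bdN_substS] at hP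
  obtain ⟨N, hN, hNn, hNq, hNm, hNp⟩ :
      ∃ N, φ.bdN ≤ N ∧ n < N ∧ q < N ∧ m < N ∧ p < N :=
    ⟨φ.bdN + n + q + m + p + 1, by omega, by omega, by omega, by omega, by omega⟩
  have hNφ : N ∉ φ.fvN := SFm.notMem_fvN_of_bdN_le hN
  have hmX : ∀ X, m ∉ (φ.substS k ix X).fvN := fun X => by rw [SFm.fvN_substS]; exact hm.1
  have hA1 : ∀ x, ∃ X, P X x ∧ ∀ Z, P Z x → ∀ y, h.Mem k X y ↔ h.Mem k Z y := by
    intro x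
    obtain ⟨a, ha, rfl⟩ := h.exists_var x (N + 1)
    have h1 := h.allN_inst hH (t := .var a) (SFm.freeForN_var (by
      simp [SFm.bdN, SFm.iff, NTm.maxVar, SFm.bdN_substS]; omega))
    have hqn : q ≠ n := hq.2
    simp only [SFm.substN, SFm.iff, NTm.subst, hqn, if_false] at h1
    obtain ⟨X, hXz, h2⟩ := h.exS_wit h1 (iz + 1)
    have hsub : ((φ.substS k ix iz).substN n (.var a)).substS k ix X =
        (φ.substS k ix iz).substN n (.var a) := SFm.substS_of_notMem _ (by
      rw [SFm.fvS_substN]; exact SFm.notMem_fvS_substS hφ' hizx)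
    simp [SFm.substS, hizx, h.and_mem, hsub] at h2
    refine ⟨X, (hP X a (by omega)).1 (by rw [SFm.substN_substS]; exact h2.1), fun Z hZ => ?_⟩
    have h3 := (h.allS_iff (by simp [SFm.noSetQ, SFm.noSetQ_substN, SFm.noSetQ_substS, hφ'])).1
      h2.2 Z
    have hXz' : ¬ X = iz := by omega
    simp only [SFm.substS, and_self, if_true, hXz', and_false, if_false] at h3
    rw [← SFm.substN_substS, SFm.substS_substS hφ' Z hiz] at h3
    refine (h.allN_iff 0 _ fun c _ => ?_).1 (h.mp h3 ((hP Z a (by omega)).2 hZ))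
    rw [← h.mem_mem, ← h.mem_mem, ← h.iff_mem]
    simp [SFm.substN, NTm.subst, SFm.iff]
  have hψ : ∀ c ≥ N + 1, (SFm.exS k ix (.exN n (.exN m ((pairEq (.var N) (.var n) (.var m)).and
      (φ.and (.mem k (.var m) ix)))))).substN N (.var c) ∈ H ↔
      ∃ X x y, h.IsPair (h.num (.var c)) x y ∧ P X x ∧ h.Mem k X y := by
    intro c hc
    have hNn' : n ≠ N := by omega
    have hNm' : m ≠ N := by omega
    simp only [SFm.substN, SFm.pairEq_substN, NTm.subst, hNn', hNm', if_false, if_true,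
      SFm.substN_of_notMem _ hNφ]
    rw [h.exS_iff (by simp [SFm.noSetQ, pairEq, hφ'])]
    refine exists_congr fun X => ?_
    simp only [SFm.substS, SFm.pairEq_substS, and_self, if_true]
    refine h.exN_iff (c + 1) _ fun a ha => ?_
    have hcn' : c ≠ n := by omega
    have hcm' : c ≠ m := by omega
    have ham' : a ≠ m := by omega
    simp only [SFm.substN, SFm.pairEq_substN, NTm.subst, hcn', hm.2, if_false, if_true]
    refine h.exN_iff (c + 1) _ fun b hb => ?_
    have : m ∉ ((φ.substS k ix X).substN n (.var a)).fvN :=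
      SFm.notMem_fvN_substN (hmX X) _ (by simpa [NTm.fv] using ham'.symm)
    simp only [SFm.substN, SFm.pairEq_substN, NTm.subst, hcm', ham', if_false, if_true,
      SFm.substN_of_notMem _ this]
    rw [h.and_mem, h.and_mem, h.pairEq_mem, h.mem_mem, hP X a (by omega)]
  have hΦ : ∀ c ≥ N + 1, (SFm.allS k ix (.and (.exN n (.exN m (pairEq (.var N) (.var n) (.var m))))
      (.allN n (.allN m ((pairEq (.var N) (.var n) (.var m)).imp
        (φ.imp (.mem k (.var m) ix))))))).substN N (.var c) ∈ H ↔
      ∀ X, (∃ x y, h.IsPair (h.num (.var c)) x y) ∧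
        ∀ x y, h.IsPair (h.num (.var c)) x y → P X x → h.Mem k X y := by
    intro c hc
    have hNn' : n ≠ N := by omega
    have hNm' : m ≠ N := by omega
    have hcn' : c ≠ n := by omega
    have hcm' : c ≠ m := by omega
    simp only [SFm.substN, SFm.pairEq_substN, NTm.subst, hNn', hNm', if_false, if_true,
      SFm.substN_of_notMem _ hNφ]
    rw [h.allS_iff (by simp [SFm.noSetQ, pairEq, hφ'])]
    refine forall_congr' fun X => ?_
    simp only [SFm.substS, SFm.pairEq_substS, and_self, if_true, h.and_mem]
    refine and_congr (h.exN_iff (c + 1) _ fun a ha => ?_) (h.allN_iff (c + 1) _ fun a ha => ?_)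
    · have ham' : a ≠ m := by omega
      simp only [SFm.substN, SFm.pairEq_substN, NTm.subst, hcn', hm.2, if_false, if_true]
      refine h.exN_iff (c + 1) _ fun b hb => ?_
      simp only [SFm.pairEq_substN, NTm.subst, hcm', ham', if_false, if_true]
      exact h.pairEq_mem
    · have ham' : a ≠ m := by omega
      simp only [SFm.substN, SFm.pairEq_substN, NTm.subst, hcn', hm.2, if_false, if_true]
      refine h.allN_iff (c + 1) _ fun b hb => ?_
      have : m ∉ ((φ.substS k ix X).substN n (.var a)).fvN :=
      SFm.notMem_fvN_substN (hmX X) _ (by simpa [NTm.fv] using ham'.symm)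
      simp only [SFm.substN, SFm.pairEq_substN, NTm.subst, hcm', ham', if_false, if_true,
        SFm.substN_of_notMem _ this]
      rw [h.imp_mem, h.imp_mem, h.pairEq_mem, h.mem_mem, hP X a (by omega)]
  have hY : ∃ Y ≥ φ.bdS + ix + iy + 1, ∀ z, h.Mem (k + 1) Y z ↔
      ∃ X x y, h.IsPair z x y ∧ P X x ∧ h.Mem k X y := by
    have h1 := h.prov (.extra (hD (.and (.exN n (.exN m (pairEq (.var N) (.var n) (.var m))))
      (.allN n (.allN m ((pairEq (.var N) (.var n) (.var m)).imp
        (φ.imp (.mem k (.var m) ix))))))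
      (.exN n (.exN m ((pairEq (.var N) (.var n) (.var m)).and
      (φ.and (.mem k (.var m) ix))))) N ix iy (by simp [SFm.noSetQ, pairEq, hφ'])
        (by simp [SFm.noSetQ, pairEq, hφ']) (by simp [SFm.fvS, pairEq, hiy])
        (by simp [SFm.fvS, pairEq, hiy])) trivial)
    have h2 := h.mp h1 ((h.allN_iff (N + 1) (fun c => (∀ X, (∃ x y, h.IsPair c x y) ∧
        ∀ x y, h.IsPair c x y → P X x → h.Mem k X y) ↔
      ∃ X x y, h.IsPair c x y ∧ P X x ∧ h.Mem k X y) (fun c hc => by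
        rw [← hψ c hc, ← hΦ c hc, ← h.iff_mem]; rfl)).2 ?_)
    · obtain ⟨Y, hY, h3⟩ := h.exS_wit h2 (φ.bdS + ix + iy + 1)
      refine ⟨Y, hY, ?_⟩
      refine (h.allN_iff (N + 1) (fun z => h.Mem (k + 1) Y z ↔
        ∃ X x y, h.IsPair z x y ∧ P X x ∧ h.Mem k X y) (fun c hc => ?_)).1 h3
      rw [← hψ c hc]
      have hs : (φ.substS (k + 1) iy Y) = φ := SFm.substS_of_notMem _ hiy
      simp only [SFm.substS, SFm.iff, SFm.pairEq_substS, hs]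
      rw [← h.mem_mem, ← h.iff_mem]
      simp [SFm.iff, SFm.substN, NTm.subst]
    · intro c
      constructor
      · intro hc
        obtain ⟨x, y, hxy⟩ := (hc 0).1
        obtain ⟨X, hX, -⟩ := hA1 x
        exact ⟨X, x, y, hxy, hX, (hc X).2 x y hxy hX⟩
      · rintro ⟨X, x, y, hxy, hX, hy⟩ Z
        refine ⟨⟨x, y, hxy⟩, fun x' y' hxy' hZ => ?_⟩
        obtain ⟨rfl, rfl⟩ := h.isPair_inj hA hxy hxy'
        obtain ⟨W, hW, hu⟩ := hA1 x
        rwa [← hu Z hZ, hu X hX]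
  obtain ⟨Y, hYb, hY⟩ := hY
  have hB : ∀ x, ∃ X, P X x ∧ ∀ y, h.Mem k X y ↔ ∃ z, h.IsPair z x y ∧ h.Mem (k + 1) Y z := by
    intro x
    obtain ⟨X, hX, hu⟩ := hA1 x
    refine ⟨X, hX, fun y => ⟨fun hy => ?_, ?_⟩⟩
    · obtain ⟨z, hz⟩ := h.exists_isPair hA x y
      exact ⟨z, hz, (hY z).2 ⟨X, x, y, hz, hX, hy⟩⟩
    · rintro ⟨z, hz, hz'⟩
      obtain ⟨Z, x', y', hz'', hZ, hy⟩ := (hY z).1 hz'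
      obtain ⟨rfl, rfl⟩ := h.isPair_inj hA hz hz''
      exact (hu Z hZ _).2 hy
  refine h.exS_intro (j := Y) ?_ ?_
  · refine SFm.freeForS_of_eq_or (.inr ?_)
    simp [SFm.bdS, SFm.iff, pairMem, pairEq]
    omega
  · have hs : (φ.substS (k + 1) iy Y) = φ := SFm.substS_of_notMem _ hiy
    have hkk : ¬ k = k + 1 := by omega
    simp only [SFm.substS, SFm.iff, SFm.pairEq_substS, hs, pairMem, hkk, false_and, if_false,
      and_self, if_true]
    refine (h.allN_iff N _ fun a ha => ?_).2 hB
    have ham : a ≠ m := by omega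
    have hap : a ≠ p := by omega
    simp only [SFm.substN, SFm.pairEq_substN, NTm.subst, if_false, if_true, hm.2, hp.2.1]
    rw [h.exS_iff (by simp [SFm.noSetQ, pairEq, hφ', SFm.noSetQ_substN])]
    refine exists_congr fun X => ?_
    have hkk' : ¬ k + 1 = k := by omega
    simp only [SFm.substS, SFm.pairEq_substS, and_self, if_true, h.and_mem, hkk',
      false_and, if_false]
    rw [← SFm.substN_substS, hP X a (by omega)]
    refine and_congr_right fun _ => h.allN_iff N _ fun b hb => ?_
    have hpm : ¬ p = m := hp.2.2
    have hap' : a ≠ p := by omega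
    have hbp : b ≠ p := by omega
    simp only [SFm.substN, SFm.pairEq_substN, NTm.subst, if_false, if_true, hpm, ham,
      h.and_mem, h.imp_mem, h.mem_mem, ← iff_def]
    refine iff_congr Iff.rfl (h.exN_iff N _ fun c hc => ?_)
    simp only [SFm.substN, SFm.pairEq_substN, NTm.subst, if_false, if_true, hap', hbp,
      h.and_mem, h.mem_mem, h.pairEq_mem]

end Henkin

/-! ## The translation -/

theorem hatTr_sortLE (φ : SFm) : (hatTr φ).sortLE 1 := by
  induction φ <;> simp_all [hatTr, SFm.sortLE]

theorem hatTr_toS (α : AFm) : hatTr α.toS = α.toS := by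
  induction α <;> simp_all [hatTr, AFm.toS]

theorem fvN_hatTr (φ : SFm) : (hatTr φ).fvN = φ.fvN := by
  induction φ <;> simp_all [hatTr, SFm.fvN]

theorem mem_fvS_hatTr {φ : SFm} {k i : ℕ} :
    (1, Nat.pair k i) ∈ (hatTr φ).fvS ↔ (k, i) ∈ φ.fvS := by
  induction φ <;> simp_all [hatTr, SFm.fvS, Nat.pair_eq_pair]

theorem hatTr_substN (φ : SFm) (i : ℕ) (t : NTm) :
    hatTr (φ.substN i t) = (hatTr φ).substN i t := by
  induction φ with
  | allN j φ ih => by_cases hj : j = i <;> simp [hatTr, SFm.substN, hj, ih]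
  | exN j φ ih => by_cases hj : j = i <;> simp [hatTr, SFm.substN, hj, ih]
  | _ => simp_all [hatTr, SFm.substN]

theorem hatTr_substS (φ : SFm) (k i j : ℕ) :
    hatTr (φ.substS k i j) = (hatTr φ).substS 1 (Nat.pair k i) (Nat.pair k j) := by
  induction φ with
  | mem k' t l =>
    by_cases hl : k' = k ∧ l = i <;> simp [hatTr, SFm.substS, hl, Nat.pair_eq_pair]
  | allS k' l φ ih =>
    by_cases hl : k' = k ∧ l = i <;> simp [hatTr, SFm.substS, hl, ih, Nat.pair_eq_pair]
  | exS k' l φ ih =>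
    by_cases hl : k' = k ∧ l = i <;> simp [hatTr, SFm.substS, hl, ih, Nat.pair_eq_pair]
  | _ => simp_all [hatTr, SFm.substS]

theorem freeForN_hatTr {φ : SFm} {t : NTm} {i : ℕ} :
    (hatTr φ).freeForN t i ↔ φ.freeForN t i := by
  induction φ <;> simp_all [hatTr, SFm.freeForN, fvN_hatTr]

theorem freeForS_hatTr {φ : SFm} {k i j : ℕ} :
    (hatTr φ).freeForS 1 (Nat.pair k i) (Nat.pair k j) ↔ φ.freeForS k i j := by
  induction φ <;> simp_all [hatTr, SFm.freeForS, mem_fvS_hatTr, Nat.pair_eq_pair]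

theorem noSetQ_hatTr {φ : SFm} : (hatTr φ).noSetQ ↔ φ.noSetQ := by
  induction φ <;> simp_all [hatTr, SFm.noSetQ]

theorem SLogAx.hatTr {φ : SFm} (h : SLogAx φ) : SLogAx (hatTr φ) := by
  cases h with
  | pl1 φ ψ => exact .pl1 _ _
  | pl2 φ ψ χ => exact .pl2 _ _ _
  | pl3 φ ψ => exact .pl3 _ _
  | pl4 φ ψ => exact .pl4 _ _
  | pl5 φ ψ => exact .pl5 _ _
  | pl6 φ ψ => exact .pl6 _ _
  | pl7 φ ψ => exact .pl7 _ _
  | pl8 φ ψ χ => exact .pl8 _ _ _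
  | pl9 φ => exact .pl9 _
  | em φ => exact .em _
  | qa1 i φ t hf =>
    simpa only [ArXiv150408062.hatTr, hatTr_substN] using SLogAx.qa1 i _ t (freeForN_hatTr.2 hf)
  | qa2 i φ t hf =>
    simpa only [ArXiv150408062.hatTr, hatTr_substN] using SLogAx.qa2 i _ t (freeForN_hatTr.2 hf)
  | qa3 k i j φ hf =>
    simpa only [ArXiv150408062.hatTr, hatTr_substS] using SLogAx.qa3 1 _ _ _ (freeForS_hatTr.2 hf)
  | qa4 k i j φ hf =>
    simpa only [ArXiv150408062.hatTr, hatTr_substS] using SLogAx.qa4 1 _ _ _ (freeForS_hatTr.2 hf)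
  | eqRefl t => exact .eqRefl t
  | eqSubst i t u φ h1 h2 =>
    simpa only [ArXiv150408062.hatTr, hatTr_substN] using
      SLogAx.eqSubst i t u _ (freeForN_hatTr.2 h1) (freeForN_hatTr.2 h2)

/-- The translation preserves derivability as soon as it maps the non-logical axioms to
derivable formulas. -/
theorem arProv_hatTr {extra L ax : SFm → Prop} (hax : ∀ φ, ax φ → ArProv extra (hatTr φ))
    {φ : SFm} (h : SProvG L ax φ) : ArProv extra (hatTr φ) := by
  induction h with
  | axm h _ => exact .axm h.hatTr (hatTr_sortLE _)
  | extra h _ => exact hax _ h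
  | mp _ _ ih1 ih2 => exact .mp ih1 ih2
  | allRN _ hi _ ih => exact .allRN ih (by rwa [fvN_hatTr]) (hatTr_sortLE (.allN _ _))
  | exRN _ hi _ ih => exact .exRN ih (by rwa [fvN_hatTr]) (hatTr_sortLE (.exN _ _))
  | allRS _ hi _ ih => exact .allRS ih (by rwa [mem_fvS_hatTr]) (hatTr_sortLE (.allS _ _ _))
  | exRS _ hi _ ih => exact .exRS ih (by rwa [mem_fvS_hatTr]) (hatTr_sortLE (.exS _ _ _))

theorem ArithAx.of_hatTr (extra : SFm → Prop) : ArithAx fun φ => ArProv extra (hatTr φ) where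
  peano α hα := by
    rw [hatTr_toS]
    exact .extra (.inl (.peano hα)) (hatTr_toS α ▸ hatTr_sortLE _)
  ind φ i := by
    refine .extra (.inl ?_) (hatTr_sortLE _)
    simpa only [hatTr, hatTr_substN] using ArAx.ind (hatTr φ) i

theorem arProv_hatTr_deltaC {φ ψ : SFm} (n k i z : ℕ) (hφ : φ.noSetQ) (hψ : ψ.noSetQ)
    (h1 : (k + 1, z) ∉ φ.fvS) (h2 : (k + 1, z) ∉ ψ.fvS) :
    ArProv DeltaC (hatTr ((SFm.allN n ((SFm.allS k i φ).iff (.exS k i ψ))).imp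
      (.exS (k + 1) z (.allN n ((SFm.mem (k + 1) (.var n) z).iff (.exS k i ψ)))))) :=
  .extra (.inr (.intro (hatTr φ) (hatTr ψ) n _ _ _ (noSetQ_hatTr.2 hφ) (noSetQ_hatTr.2 hψ)
    (by rwa [mem_fvS_hatTr]) (by rwa [mem_fvS_hatTr]) (by simp [Nat.pair_eq_pair])
    (by simp [Nat.pair_eq_pair]))) (hatTr_sortLE _)

theorem SAx.arProv_hatTr {φ : SFm} (h : SAx φ) : ArProv DeltaC (hatTr φ) := by
  cases h with
  | peano h => exact (ArithAx.of_hatTr DeltaC).peano _ h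
  | ind φ i => exact (ArithAx.of_hatTr DeltaC).ind φ i
  | compr k z j φ h hz =>
    exact .extra (.inl (.compr _ j (hatTr φ) (noSetQ_hatTr.2 h.noSetQ) (by rwa [mem_fvS_hatTr])))
      (hatTr_sortLE _)
  | choice k φ n ix iz iy q m p h hiz hizx hq hm hp =>
    refine ArXiv150408062.arProv_hatTr (ax := fun φ => ArProv DeltaC (hatTr φ))
      (L := fun _ => True) (fun _ h => h) ?_
    by_contra hn
    obtain ⟨H, hH, hmem⟩ := exists_henkin hn
    exact hmem (hH.imp_mem.2 fun hA => hH.choice_of_deltaC (.of_hatTr DeltaC)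
      (fun φ ψ n i z => arProv_hatTr_deltaC n k i z) h hiz hizx hq hm hp hA)

/-- **Corollary (Section 3) of the paper**: the multi-sorted second-order
arithmetic SA is interpretable in `Ar + (Δ¹₁-C)` (via the sort-erasing
translation `φ ↦ φ^∧`). -/
theorem SA_interpretable_in_Ar_DeltaC :
    ∀ φ : SFm, SAProv ⊤ φ → ArProv DeltaC (hatTr φ) := by
  intro φ hφ
  exact arProv_hatTr (fun _ h => h.arProv_hatTr) hφ

end ArXiv150408062
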